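/- For every integer n ≥ 4, the (n−1)-st homotopy group of the configuration space C₂(S¹ × D^{n−1}) of 2 ordered distinct points in S¹ × D^{n−1}, at any basepoint, is isomorphic to a free abelian group of countably infinite rank, i.e. to the direct sum ⊕_{ℕ} ℤ. -/

import Mathlib

/-- The configuration space `C_k(M)` of `k` ordered distinct points in a topological
space `M`, with the subspace topology from `M^k`. -/
abbrev Conf (k : ℕ) (M : Type*) [TopologicalSpace M] : Type _ :=
  {p : Fin k → M // ∀ i j : Fin k, i ≠ j → p i ≠ p j}

/-- The manifold `S¹ × D^{n-1}`, realized as the subspace of `ℝ² × ℝ^{n-1}` of pairs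
`(z, x)` with `‖z‖ = 1` and `‖x‖ ≤ 1`. -/
abbrev S1xD (n : ℕ) : Type :=
  {p : EuclideanSpace ℝ (Fin 2) × EuclideanSpace ℝ (Fin (n - 1)) // ‖p.1‖ = 1 ∧ ‖p.2‖ ≤ 1}


namespace CP
open scoped Topology Topology.Homotopy unitInterval
open Set

section Gen
variable {N : Type*} {X Y Z : Type*} [TopologicalSpace X] [TopologicalSpace Y] [TopologicalSpace Z]

/-- The class of a generalized loop in the homotopy group. -/
def cls {x : X} (p : GenLoop N X x) : HomotopyGroup N X x :=
  Quotient.mk (GenLoop.Homotopic.setoid N x) p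

lemma cls_surj {x : X} (a : HomotopyGroup N X x) : ∃ p : GenLoop N X x, cls p = a :=
  Quotient.exists_rep a

lemma cls_eq_iff {x : X} {p q : GenLoop N X x} : cls p = cls q ↔ GenLoop.Homotopic p q :=
  Quotient.eq (r := GenLoop.Homotopic.setoid N x)

lemma cls_eq_of {x : X} {p q : GenLoop N X x} (H : I × (N → I) → X) (hH : Continuous H)
    (h0 : ∀ t, H (0, t) = p t) (h1 : ∀ t, H (1, t) = q t)
    (hb : ∀ s, ∀ t ∈ Cube.boundary N, H (s, t) = x) : cls p = cls q := by
  rw [cls_eq_iff]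
  refine ⟨⟨⟨⟨H, hH⟩, h0, h1⟩, ?_⟩⟩
  intro s t ht
  exact (hb s t ht).trans (p.2 t ht).symm

lemma exists_of_cls_eq {x : X} {p q : GenLoop N X x} (h : cls p = cls q) :
    ∃ H : I × (N → I) → X, Continuous H ∧ (∀ t, H (0, t) = p t) ∧ (∀ t, H (1, t) = q t) ∧
      ∀ s, ∀ t ∈ Cube.boundary N, H (s, t) = x := by
  rw [cls_eq_iff] at h
  obtain ⟨H⟩ := h
  refine ⟨H, H.continuous, fun t => H.apply_zero t, fun t => H.apply_one t, ?_⟩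
  intro s t ht
  exact (H.eq_fst s ht).trans (p.2 t ht)

/-- Bundle a function as a generalized loop. -/
def mkGL {x : X} (f : (N → I) → X) (hf : Continuous f)
    (hb : ∀ t ∈ Cube.boundary N, f t = x) : GenLoop N X x := ⟨⟨f, hf⟩, hb⟩

@[simp] lemma mkGL_apply {x : X} (f : (N → I) → X) (hf : Continuous f)
    (hb : ∀ t ∈ Cube.boundary N, f t = x) (t) : mkGL f hf hb t = f t := rfl

lemma gl_cont {x : X} (p : GenLoop N X x) : Continuous p := p.1.continuous

/-- pushforward of loops -/
def glMap (f : X → Y) (hf : Continuous f) {x : X} {y : Y} (h : f x = y) (p : GenLoop N X x) :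
    GenLoop N Y y :=
  mkGL (fun t => f (p t)) (hf.comp (gl_cont p)) (fun t ht => by rw [GenLoop.boundary p t ht, h])

@[simp] lemma glMap_apply (f : X → Y) (hf : Continuous f) {x : X} {y : Y} (h : f x = y)
    (p : GenLoop N X x) (t) : glMap f hf h p t = f (p t) := rfl

lemma glMap_cls (f : X → Y) (hf : Continuous f) {x : X} {y : Y} (h : f x = y)
    {p q : GenLoop N X x} (hpq : cls p = cls q) : cls (glMap f hf h p) = cls (glMap f hf h q) := by
  obtain ⟨H, hc, h0, h1, hb⟩ := exists_of_cls_eq hpq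
  refine cls_eq_of (fun z => f (H z)) (hf.comp hc) ?_ ?_ ?_
  · intro t; simp [h0]
  · intro t; simp [h1]
  · intro s t ht; simp [hb s t ht, h]

variable [DecidableEq N]

lemma transAt_apply {x : X} (i : N) (f g : GenLoop N X x) (t : N → I) :
    GenLoop.transAt i f g t = if (t i : ℝ) ≤ 1 / 2
      then f (Function.update t i <| Set.projIcc 0 1 zero_le_one (2 * t i))
      else g (Function.update t i <| Set.projIcc 0 1 zero_le_one (2 * t i - 1)) := rfl

lemma symmAt_apply {x : X} (i : N) (f : GenLoop N X x) (t : N → I) :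
    GenLoop.symmAt i f t = f fun j ↦ if j = i then unitInterval.symm (t i) else t j := rfl

variable [Nonempty N]

lemma cls_mul {x : X} (i : N) (p q : GenLoop N X x) :
    cls p * cls q = cls (GenLoop.transAt i q p) := HomotopyGroup.mul_spec

lemma cls_inv {x : X} (i : N) (p : GenLoop N X x) :
    (cls p)⁻¹ = cls (GenLoop.symmAt i p) := HomotopyGroup.inv_spec

lemma cls_const {x : X} : cls (GenLoop.const : GenLoop N X x) = 1 := rfl

lemma hg_comm [Nontrivial N] {x : X} (a b : HomotopyGroup N X x) : a * b = b * a :=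
  mul_comm a b

/-- The induced homomorphism. -/
noncomputable def hgMap (f : X → Y) (hf : Continuous f) {x : X} {y : Y} (h : f x = y) :
    HomotopyGroup N X x →* HomotopyGroup N Y y :=
  MonoidHom.mk' (Quotient.lift (fun p => cls (glMap f hf h p)) (fun p q hpq =>
    glMap_cls f hf h (cls_eq_iff.2 hpq))) (by
    intro a b
    obtain ⟨p, rfl⟩ := cls_surj a
    obtain ⟨q, rfl⟩ := cls_surj b
    have i : N := Classical.arbitrary N
    rw [cls_mul i]
    change cls (glMap f hf h _) = cls (glMap f hf h _) * cls (glMap f hf h _)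
    rw [cls_mul i]
    congr 1
    ext t
    simp only [glMap_apply, transAt_apply]
    split_ifs <;> rfl)

@[simp] lemma hgMap_cls (f : X → Y) (hf : Continuous f) {x : X} {y : Y} (h : f x = y)
    (p : GenLoop N X x) : hgMap f hf h (cls p) = cls (glMap f hf h p) := rfl

/-- pointed homotopic maps induce the same map -/
lemma hgMap_of_homotopic {f : X → X} (hf : Continuous f) {x : X} (h : f x = x)
    (H : I × X → X) (hH : Continuous H) (h0 : ∀ z, H (0, z) = f z) (h1 : ∀ z, H (1, z) = z)
    (hx : ∀ s, H (s, x) = x) (a : HomotopyGroup N X x) : hgMap f hf h a = a := by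
  obtain ⟨p, rfl⟩ := cls_surj a
  rw [hgMap_cls]
  refine cls_eq_of (fun z => H (z.1, p z.2)) ?_ ?_ ?_ ?_
  · exact hH.comp (continuous_fst.prodMk ((gl_cont p).comp continuous_snd))
  · intro t; simp [h0]
  · intro t; simp [h1]
  · intro s t ht; simp [GenLoop.boundary p t ht, hx]

/-- pointed homotopy equivalences induce isomorphisms -/
lemma hgEquiv_of_homotopyEquiv {f : X → Y} {g : Y → X} (hf : Continuous f) (hg : Continuous g)
    {x : X} {y : Y} (hx : f x = y) (hy : g y = x)
    (H : I × X → X) (hH : Continuous H) (h0 : ∀ z, H (0, z) = g (f z)) (h1 : ∀ z, H (1, z) = z)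
    (hHx : ∀ s, H (s, x) = x)
    (K : I × Y → Y) (hK : Continuous K) (k0 : ∀ z, K (0, z) = f (g z)) (k1 : ∀ z, K (1, z) = z)
    (hKy : ∀ s, K (s, y) = y) :
    Nonempty (HomotopyGroup N X x ≃* HomotopyGroup N Y y) := by
  refine ⟨MulEquiv.ofBijective (hgMap f hf hx) ⟨?_, ?_⟩⟩
  · apply Function.LeftInverse.injective (g := hgMap g hg hy)
    intro a
    have := hgMap_of_homotopic (hg.comp hf) (by simp [hx, hy]) H hH h0 h1 hHx a
    obtain ⟨p, rfl⟩ := cls_surj a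
    exact this
  · apply Function.RightInverse.surjective (g := hgMap g hg hy)
    intro a
    have := hgMap_of_homotopic (hf.comp hg) (by simp [hx, hy]) K hK k0 k1 hKy a
    obtain ⟨p, rfl⟩ := cls_surj a
    exact this

lemma hgEquiv_of_homeo (e : X ≃ₜ Y) {x : X} {y : Y} (hx : e x = y) :
    Nonempty (HomotopyGroup N X x ≃* HomotopyGroup N Y y) := by
  refine hgEquiv_of_homotopyEquiv e.continuous e.symm.continuous hx (by simp [← hx])
    (fun z => z.2) continuous_snd (by simp) (by simp) (by simp)
    (fun z => z.2) continuous_snd (by simp) (by simp) (by simp)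

end Gen

/-- The algebraic recognition lemma. -/
lemma free_of_gens {G : Type*} [Group G] (hcomm : ∀ a b : G, a * b = b * a) (g : ℤ → G)
    (hg : Subgroup.closure (Set.range g) = ⊤) {A : Type*} [AddCommGroup A]
    (htf : ∀ (z : ℤ) (a : A), z • a = 0 → z = 0 ∨ a = 0)
    (D : ℤ → G →* Multiplicative A)
    (h0 : ∀ j k, j ≠ k → D k (g j) = 1) (h1 : ∀ k, D k (g k) ≠ 1) :
    Nonempty (G ≃* Multiplicative (ℕ →₀ ℤ)) := by
  letI : CommGroup G := { (inferInstance : Group G) with mul_comm := hcomm }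
  let F : Multiplicative (ℤ →₀ ℤ) →* G :=
    AddMonoidHom.toMultiplicativeLeft
      (Finsupp.liftAddHom (fun k => (zmultiplesHom (Additive G) (Additive.ofMul (g k)))))
  have hF : ∀ k z, F (Multiplicative.ofAdd (Finsupp.single k z)) = g k ^ z := by
    intro k z
    simp [F]
  have hFsum : ∀ l : ℤ →₀ ℤ, F (Multiplicative.ofAdd l) = l.prod (fun k z => g k ^ z) := by
    intro l
    induction l using Finsupp.induction_linear with
    | zero => simp
    | add a b ha hb =>
      rw [ofAdd_add, map_mul, ha, hb, Finsupp.prod_add_index']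
      · simp
      · intro k x y; exact zpow_add _ _ _
    | single k z => rw [hF]; simp
  have hsurj : Function.Surjective F := by
    rw [← MonoidHom.range_eq_top, eq_top_iff, ← hg, Subgroup.closure_le]
    rintro _ ⟨k, rfl⟩
    exact ⟨Multiplicative.ofAdd (Finsupp.single k 1), by rw [hF]; simp⟩
  have hinj : Function.Injective F := by
    rw [injective_iff_map_eq_one]
    intro l hl
    apply Multiplicative.toAdd.injective
    change Multiplicative.toAdd l = 0
    generalize hl' : Multiplicative.toAdd l = l' at *
    have : l = Multiplicative.ofAdd l' := by rw [← hl']; simp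
    rw [this, hFsum] at hl
    ext k
    have h2 := congrArg (D k) hl
    rw [map_one, Finsupp.prod, map_prod] at h2
    rw [Finset.prod_eq_single k] at h2
    · rw [map_zpow] at h2
      have h3 : l' k • Multiplicative.toAdd (D k (g k)) = 0 := by
        rw [← toAdd_zpow, h2]; rfl
      rcases htf _ _ h3 with h | h
      · simpa using h
      · exact absurd (Multiplicative.toAdd.injective h) (h1 k)
    · intro j _ hj
      rw [map_zpow, h0 j k hj, one_zpow]
    · intro hk
      simp [Finsupp.notMem_support_iff.1 hk]
  have e1 : Multiplicative (ℤ →₀ ℤ) ≃* G := MulEquiv.ofBijective F ⟨hinj, hsurj⟩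
  have e2 : (ℤ →₀ ℤ) ≃+ (ℕ →₀ ℤ) :=
    Finsupp.domCongr (Equiv.intEquivNat)
  exact ⟨e1.symm.trans (AddEquiv.toMultiplicative e2)⟩

end CP

namespace CP
open scoped Topology Topology.Homotopy unitInterval
open Set

/-- The model Euclidean space `ℝ^(d+1)`. -/
abbrev E (d : ℕ) : Type := Fin (d + 1) → ℝ
/-- The ambient space of the model. -/
abbrev W (d : ℕ) : Type := ℝ × E d

/-- Puncture positions. -/
def kap (d : ℕ) (k : ℤ) : E d := Pi.single 0 (k : ℝ)

/-- The set of punctures. -/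
def Pun (d : ℕ) : Set (W d) := {y | y.1 = 0 ∧ ∃ k : ℤ, y.2 = kap d k}

/-- The model space. -/
abbrev Ym (d : ℕ) : Type := {y : W d // y ∉ Pun d}

/-- outside of the open unit cube -/
def Out {d : ℕ} (x : E d) : Prop := ∃ i, x i ≤ 0 ∨ 1 ≤ x i

/-- Loops defined on the whole Euclidean space, constant outside of the cube -/
structure RL {d : ℕ} (b : Ym d) where
  toFun : E d → W d
  cont : Continuous toFun
  avoid : ∀ x, toFun x ∉ Pun d
  bd : ∀ x, Out x → toFun x = b

variable {d : ℕ} {b : Ym d}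

instance : CoeFun (RL b) (fun _ => E d → W d) := ⟨RL.toFun⟩

@[ext] lemma RL.ext' {f g : RL b} (h : ∀ x, f x = g x) : f = g := by
  cases f; cases g; congr; funext x; exact h x

/-- the associated generalized loop -/
def RL.gl (f : RL b) : GenLoop (Fin (d + 1)) (Ym d) b :=
  mkGL (fun t => ⟨f (fun i => (t i : ℝ)), f.avoid _⟩)
    (Continuous.subtype_mk (f.cont.comp (by fun_prop)) _)
    (by
      rintro t ⟨i, hi⟩
      apply Subtype.ext
      apply f.bd
      refine ⟨i, ?_⟩
      rcases hi with hi | hi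
      · left; simp [hi]
      · right; simp [hi])

/-- the class of a loop -/
def lc (f : RL b) : HomotopyGroup (Fin (d + 1)) (Ym d) b := cls f.gl

lemma gl_apply (f : RL b) (t) : ((f.gl t : Ym d) : W d) = f (fun i => (t i : ℝ)) := rfl

/-- clamp a point to the cube -/
noncomputable def clE {d : ℕ} (x : E d) : Fin (d + 1) → I := fun i => Set.projIcc 0 1 zero_le_one (x i)

lemma clE_cont : Continuous (clE : E d → _) := by
  unfold clE
  exact continuous_pi fun i => continuous_projIcc.comp (continuous_apply i)

lemma clE_out {x : E d} (h : Out x) : clE x ∈ Cube.boundary (Fin (d + 1)) := by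
  obtain ⟨i, hi⟩ := h
  refine ⟨i, ?_⟩
  rcases hi with hi | hi
  · left; exact Set.projIcc_of_le_left _ hi
  · right; exact Set.projIcc_of_right_le _ hi

lemma clE_coe (t : Fin (d + 1) → I) : clE (fun i => (t i : ℝ)) = t := by
  funext i; simp [clE]

lemma lc_surj (a : HomotopyGroup (Fin (d + 1)) (Ym d) b) : ∃ f : RL b, lc f = a := by
  obtain ⟨p, rfl⟩ := cls_surj a
  refine ⟨⟨fun x => (p (clE x) : Ym d), ?_, fun x => (p (clE x)).2, ?_⟩, ?_⟩
  · exact continuous_subtype_val.comp ((gl_cont p).comp clE_cont)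
  · intro x hx
    rw [GenLoop.boundary p _ (clE_out hx)]
  · unfold lc
    congr 1
    ext t
    · simp [gl_apply, clE_coe]
    · simp [gl_apply, clE_coe]

lemma lc_eq_of {f g : RL b} (H : ℝ → E d → W d)
    (hH : Continuous (fun z : ℝ × E d => H z.1 z.2))
    (h0 : ∀ x, H 0 x = f x) (h1 : ∀ x, H 1 x = g x)
    (ha : ∀ t ∈ Icc (0 : ℝ) 1, ∀ x, H t x ∉ Pun d)
    (hb : ∀ t ∈ Icc (0 : ℝ) 1, ∀ x, Out x → H t x = b) : lc f = lc g := by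
  refine cls_eq_of (fun z => ⟨H z.1 (fun i => (z.2 i : ℝ)), ha _ z.1.2 _⟩) ?_ ?_ ?_ ?_
  · refine Continuous.subtype_mk ?_ _
    exact hH.comp (f := fun z : I × (Fin (d + 1) → I) => ((z.1 : ℝ), fun i => (z.2 i : ℝ)))
      (by fun_prop)
  · intro t; apply Subtype.ext; simp [h0, gl_apply]
  · intro t; apply Subtype.ext; simp [h1, gl_apply]
  · rintro s t ⟨i, hi⟩
    apply Subtype.ext
    apply hb _ s.2
    refine ⟨i, ?_⟩
    rcases hi with hi | hi
    · left; simp [hi]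
    · right; simp [hi]

lemma RL.coe_clE (f : RL b) (x : E d) : f (fun i => (clE x i : ℝ)) = f x := by
  by_cases h : Out x
  · rw [f.bd x h, f.bd]
    obtain ⟨i, hi⟩ := clE_out h
    refine ⟨i, ?_⟩
    rcases hi with hi | hi
    · left; simp [hi]
    · right; simp [hi]
  · congr 1
    funext i
    simp only [Out, not_exists, not_or, not_le] at h
    exact congrArg Subtype.val (Set.projIcc_of_mem zero_le_one ⟨(h i).1.le, (h i).2.le⟩)

lemma exists_of_lc_eq {f g : RL b} (h : lc f = lc g) : ∃ H : ℝ → E d → W d,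
    Continuous (fun z : ℝ × E d => H z.1 z.2) ∧ (∀ t ≤ 0, ∀ x, H t x = f x) ∧
    (∀ t, 1 ≤ t → ∀ x, H t x = g x) ∧
    (∀ t x, H t x ∉ Pun d) ∧ (∀ t x, Out x → H t x = b) := by
  obtain ⟨H, hc, h0, h1, hb⟩ := exists_of_cls_eq h
  refine ⟨fun t x => (H (Set.projIcc 0 1 zero_le_one t, clE x) : Ym d), ?_, ?_, ?_, ?_, ?_⟩
  · refine continuous_subtype_val.comp (hc.comp ?_)
    exact (continuous_projIcc.comp continuous_fst).prodMk (clE_cont.comp continuous_snd)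
  · intro t ht x
    dsimp only
    rw [Set.projIcc_of_le_left _ ht]
    erw [h0]
    rw [gl_apply, f.coe_clE]
  · intro t ht x
    dsimp only
    rw [Set.projIcc_of_right_le _ ht]
    erw [h1]
    rw [gl_apply, g.coe_clE]
  · intro t x; exact (H _).2
  · intro t x hx
    dsimp only
    rw [hb _ _ (clE_out hx)]

open Function in
/-- Concatenation in the `i`-th direction. -/
def RL.trans (i : Fin (d + 1)) (f g : RL b) : RL b where
  toFun x := f (update x i (2 * x i)) + g (update x i (2 * x i - 1)) - b
  cont := by
    have := f.cont; have := g.cont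
    refine ((f.cont.comp ?_).add (g.cont.comp ?_)).sub continuous_const
    · exact continuous_id.update i (by fun_prop)
    · exact continuous_id.update i (by fun_prop)
  avoid x := by
    rcases le_total (x i) (1/2) with h | h
    · rw [g.bd (update x i (2 * x i - 1)) ⟨i, by left; simp; linarith⟩]
      simpa using f.avoid _
    · rw [f.bd (update x i (2 * x i)) ⟨i, by right; simp; linarith⟩]
      simpa using g.avoid _
  bd x hx := by
    have h1 : Out (update x i (2 * x i)) := by
      obtain ⟨j, hj⟩ := hx
      refine ⟨j, ?_⟩
      by_cases h : j = i
      · subst h; simp; rcases hj with hj | hj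
        · left; linarith
        · right; linarith
      · simpa [h] using hj
    have h2 : Out (update x i (2 * x i - 1)) := by
      obtain ⟨j, hj⟩ := hx
      refine ⟨j, ?_⟩
      by_cases h : j = i
      · subst h; simp; rcases hj with hj | hj
        · left; linarith
        · right; linarith
      · simpa [h] using hj
    rw [f.bd _ h1, g.bd _ h2]; simp

lemma RL.trans_left (i : Fin (d + 1)) (f g : RL b) (x : E d) (h : x i ≤ 1/2) :
    RL.trans i f g x = f (Function.update x i (2 * x i)) := by
  simp only [RL.trans]
  rw [g.bd (Function.update x i (2 * x i - 1)) ⟨i, by left; simp; linarith⟩]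
  simp

lemma RL.trans_right (i : Fin (d + 1)) (f g : RL b) (x : E d) (h : 1/2 ≤ x i) :
    RL.trans i f g x = g (Function.update x i (2 * x i - 1)) := by
  simp only [RL.trans]
  rw [f.bd (Function.update x i (2 * x i)) ⟨i, by right; simp; linarith⟩]
  simp

lemma lc_trans (i : Fin (d + 1)) (f g : RL b) : lc (RL.trans i f g) = lc g * lc f := by
  unfold lc
  rw [cls_mul i]
  congr 1
  refine GenLoop.ext _ _ fun t => ?_
  rw [transAt_apply]
  have ht := (t i).2
  split_ifs with h
  · apply Subtype.ext
    rw [gl_apply, gl_apply, RL.trans_left i f g _ h]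
    congr 1
    funext j
    by_cases hj : j = i
    · subst hj
      simp only [Function.update_self]
      rw [Set.projIcc_of_mem zero_le_one ⟨by linarith [ht.1], by linarith⟩]
    · simp [hj]
  · apply Subtype.ext
    push Not at h
    rw [gl_apply, gl_apply, RL.trans_right i f g _ h.le]
    congr 1
    funext j
    by_cases hj : j = i
    · subst hj
      simp only [Function.update_self]
      rw [Set.projIcc_of_mem zero_le_one ⟨by linarith [ht.1], by linarith [ht.2]⟩]
    · simp [hj]

lemma lc_inv (i : Fin (d + 1)) (f g : RL b)
    (h : ∀ x, g x = f (Function.update x i (1 - x i))) : lc g = (lc f)⁻¹ := by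
  unfold lc
  rw [cls_inv i]
  congr 1
  refine GenLoop.ext _ _ fun t => ?_
  rw [symmAt_apply]
  apply Subtype.ext
  rw [gl_apply, gl_apply, h]
  congr 1
  funext j
  by_cases hj : j = i
  · subst hj; simp
  · simp [hj]

/-- the constant loop -/
def RL.const (b : Ym d) : RL b := ⟨fun _ => b, continuous_const, fun _ => b.2, fun _ _ => rfl⟩

lemma lc_const : lc (RL.const b) = 1 := by
  rw [← cls_const]; rfl

end CP

namespace CP
open scoped Topology Topology.Homotopy unitInterval
open Set

/-- clamp to the unit interval -/
noncomputable def clam (t : ℝ) : ℝ := max 0 (min 1 t)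

lemma clam_cont : Continuous clam := by unfold clam; fun_prop
lemma clam_nonneg (t : ℝ) : 0 ≤ clam t := le_max_left _ _
lemma clam_le_one (t : ℝ) : clam t ≤ 1 := max_le zero_le_one (min_le_left _ _)
lemma clam_of_nonpos {t : ℝ} (h : t ≤ 0) : clam t = 0 := by
  unfold clam; rw [max_eq_left]; exact (min_le_right _ _).trans h
lemma clam_of_one_le {t : ℝ} (h : 1 ≤ t) : clam t = 1 := by
  unfold clam; rw [min_eq_left h]; norm_num
lemma clam_of_mem {t : ℝ} (h0 : 0 ≤ t) (h : t ≤ 1) : clam t = t := by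
  unfold clam; rw [min_eq_right h, max_eq_right h0]
@[simp] lemma clam_zero : clam 0 = 0 := clam_of_nonpos le_rfl
@[simp] lemma clam_one : clam 1 = 1 := clam_of_one_le le_rfl

variable {d : ℕ} {b : Ym d}

lemma kap_sub_norm {j k : ℤ} (h : j ≠ k) : 1 ≤ ‖kap d j - kap d k‖ := by
  have h1 : ‖(kap d j - kap d k) 0‖ ≤ ‖kap d j - kap d k‖ := norm_le_pi_norm _ 0
  refine le_trans ?_ h1
  simp only [kap, Pi.sub_apply, Pi.single_eq_same, Real.norm_eq_abs]
  have : (1 : ℤ) ≤ |j - k| := Int.one_le_abs (sub_ne_zero.2 h)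
  exact_mod_cast this

/-- The contractible part -/
def Cs (d : ℕ) : Set (W d) := {y | ∀ k : ℤ, y.2 = kap d k → y.1 < 0}

lemma Cs_not_pun {y : W d} (h : y ∈ Cs d) : y ∉ Pun d := by
  rintro ⟨h1, k, hk⟩
  have := h k hk
  linarith

/-- The contraction. -/
noncomputable def hc (b : W d) (t : ℝ) (y : W d) : W d :=
  ((1 - max (2 * t - 1) 0) * (y.1 - min (2 * t) 1 * max (y.1 - b.1) 0) + max (2 * t - 1) 0 * b.1,
   (1 - max (2 * t - 1) 0) • y.2 + max (2 * t - 1) 0 • b.2)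

lemma hc_cont (b : W d) : Continuous (fun z : ℝ × W d => hc b z.1 z.2) := by
  unfold hc; fun_prop

lemma hc_zero (b y : W d) : hc b 0 y = y := by
  unfold hc; ext <;> simp

lemma hc_one (b y : W d) : hc b 1 y = b := by
  unfold hc; norm_num

lemma hc_base (b : W d) (t : ℝ) : hc b t b = b := by
  unfold hc; ext
  · simp; ring
  · simp; ring

lemma hc_half (b y : W d) {t : ℝ} (ht : t ≤ 1/2) :
    hc b t y = (y.1 - (2 * t) * max (y.1 - b.1) 0, y.2) := by
  unfold hc
  rw [max_eq_right (by linarith : 2 * t - 1 ≤ 0), min_eq_left (by linarith)]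
  simp

lemma hc_half' (b y : W d) {t : ℝ} (ht : 1/2 ≤ t) (ht1 : t ≤ 1) : (hc b t y).1 ≤ b.1 := by
  unfold hc
  rw [max_eq_left (by linarith : 0 ≤ 2 * t - 1), min_eq_right (by linarith)]
  dsimp only
  have : y.1 - 1 * max (y.1 - b.1) 0 ≤ b.1 := by
    have := le_max_left (y.1 - b.1) 0; linarith
  nlinarith

lemma hc_Cs {b : W d} (hb : b.1 < 0) {t : ℝ} (h0 : 0 ≤ t) (h1 : t ≤ 1) {y : W d}
    (hy : y ∈ Cs d) : hc b t y ∈ Cs d := by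
  rcases le_total t (1/2) with h | h
  · rw [hc_half b y h]
    intro k hk
    have h2 := hy k hk
    have h3 : 0 ≤ max (y.1 - b.1) 0 := le_max_right _ _
    have : 0 ≤ (2 * t) * max (y.1 - b.1) 0 := by positivity
    dsimp only
    linarith
  · intro k hk
    exact (hc_half' b y h h1).trans_lt hb

/-- bad points -/
def RL.bad (f : RL b) : Set (E d) := {x | ∃ k : ℤ, (f x).2 = kap d k ∧ 0 < (f x).1}

lemma not_bad_iff (f : RL b) (x : E d) : x ∉ f.bad ↔ f x ∈ Cs d := by
  constructor
  · intro h k hk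
    by_contra h2
    push Not at h2
    rcases h2.lt_or_eq with h3 | h3
    · exact h ⟨k, hk, h3⟩
    · exact f.avoid x ⟨h3.symm, k, hk⟩
  · rintro h ⟨k, hk, h3⟩
    have := h k hk
    linarith

lemma bad_not_out (hb : b.1.1 < 0) (f : RL b) {x : E d} (h : x ∈ f.bad) : ¬ Out x := by
  intro ho
  obtain ⟨k, _, h2⟩ := h
  rw [f.bd x ho] at h2
  linarith

/-- pushing the good part towards the base point -/
noncomputable def RL.push (hb : b.1.1 < 0) (f : RL b) (χ : E d → ℝ) (hχ : Continuous χ)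
    (h0 : ∀ x, 0 ≤ χ x) (h1 : ∀ x, χ x ≤ 1) (hbad : ∀ x ∈ f.bad, χ x = 0) : RL b where
  toFun x := hc b (χ x) (f x)
  cont := (hc_cont b.1).comp (hχ.prodMk f.cont)
  avoid x := by
    by_cases h : x ∈ f.bad
    · rw [hbad x h, hc_zero]; exact f.avoid x
    · exact Cs_not_pun (hc_Cs hb (h0 x) (h1 x) ((not_bad_iff f x).1 h))
  bd x hx := by rw [f.bd x hx, hc_base]

lemma lc_push (hb : b.1.1 < 0) (f : RL b) (χ : E d → ℝ) (hχ : Continuous χ)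
    (h0 : ∀ x, 0 ≤ χ x) (h1 : ∀ x, χ x ≤ 1) (hbad : ∀ x ∈ f.bad, χ x = 0) :
    lc (f.push hb χ hχ h0 h1 hbad) = lc f := by
  symm
  refine lc_eq_of (fun t x => hc b (t * χ x) (f x)) ?_ ?_ ?_ ?_ ?_
  · have := f.cont
    exact (hc_cont b.1).comp (f := fun z : ℝ × E d => (z.1 * χ z.2, f z.2)) (by fun_prop)
  · intro x; simp [hc_zero]
  · intro x; simp [RL.push]
  · intro t ht x
    by_cases h : x ∈ f.bad
    · rw [hbad x h, mul_zero, hc_zero]; exact f.avoid x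
    · exact Cs_not_pun (hc_Cs hb (mul_nonneg ht.1 (h0 x))
        (mul_le_one₀ ht.2 (h0 x) (h1 x)) ((not_bad_iff f x).1 h))
  · intro t _ x hx
    rw [f.bd x hx, hc_base]

lemma bad_push (hb : b.1.1 < 0) (f : RL b) (χ : E d → ℝ) (hχ : Continuous χ)
    (h0 : ∀ x, 0 ≤ χ x) (h1 : ∀ x, χ x ≤ 1) (hbad : ∀ x ∈ f.bad, χ x = 0) :
    (f.push hb χ hχ h0 h1 hbad).bad = f.bad := by
  ext x
  by_cases h : x ∈ f.bad
  · refine ⟨fun _ => h, fun _ => ?_⟩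
    have : (f.push hb χ hχ h0 h1 hbad) x = f x := by
      simp [RL.push, hbad x h, hc_zero]
    obtain ⟨k, hk⟩ := h
    exact ⟨k, by rwa [this]⟩
  · refine ⟨fun h' => absurd h' ?_, fun h' => absurd h' h⟩
    rw [not_bad_iff] at h ⊢
    exact hc_Cs hb (h0 x) (h1 x) h

/-! ### local models -/

/-- cutoff function -/
noncomputable def cut (δ : ℝ) (z : E d) : ℝ := clam (2 * ‖z‖ / δ - 1)

lemma cut_nonneg (δ : ℝ) (z : E d) : 0 ≤ cut δ z := clam_nonneg _
lemma cut_le_one (δ : ℝ) (z : E d) : cut δ z ≤ 1 := clam_le_one _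
lemma cut_zero (δ : ℝ) : cut δ (0 : E d) = 0 := by
  unfold cut; apply clam_of_nonpos; simp
lemma cut_far {δ : ℝ} (hδ : 0 < δ) {z : E d} (h : δ ≤ ‖z‖) : cut δ z = 1 := by
  unfold cut; apply clam_of_one_le
  have : 1 ≤ ‖z‖ / δ := by rwa [le_div_iff₀ hδ, one_mul]
  have h2 : 2 * ‖z‖ / δ = 2 * (‖z‖ / δ) := by ring
  rw [h2]; linarith
lemma cut_near {δ : ℝ} (hδ : 0 < δ) {z : E d} (h : ‖z‖ ≤ δ / 2) : cut δ z = 0 := by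
  unfold cut; apply clam_of_nonpos
  have : 2 * ‖z‖ / δ ≤ 1 := by rw [div_le_one hδ]; linarith
  linarith

/-- validity of the parameters of a local model -/
structure Valid (A : E d →L[ℝ] E d) (x0 : E d) (δ : ℝ) : Prop where
  pos : 0 < δ
  inj : ∀ z, A z = 0 → z = 0
  small : ∀ z, ‖z‖ ≤ δ → ‖A z‖ < 1
  cube : ∀ i, δ ≤ x0 i ∧ x0 i ≤ 1 - δ

lemma far_of_out {x0 : E d} {δ : ℝ} (h : ∀ i, δ ≤ x0 i ∧ x0 i ≤ 1 - δ) {x : E d} (hx : Out x) :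
    δ ≤ ‖x - x0‖ := by
  obtain ⟨i, hi⟩ := hx
  have h1 : ‖(x - x0) i‖ ≤ ‖x - x0‖ := norm_le_pi_norm _ i
  refine le_trans ?_ h1
  rw [Pi.sub_apply, Real.norm_eq_abs]
  have := h i
  rcases hi with hi | hi
  · rw [abs_sub_comm]; exact le_trans (by linarith) (le_abs_self _)
  · exact le_trans (by linarith) (le_abs_self _)

lemma kap_add_mem_Cs {k : ℤ} {v : E d} (h0 : v ≠ 0) (h1 : ‖v‖ < 1) (s : ℝ) :
    ((s, kap d k + v) : W d) ∈ Cs d := by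
  intro j hj
  exfalso
  have h2 : kap d j - kap d k = v := by rw [← hj]; simp
  by_cases h : j = k
  · subst h; simp at h2; exact h0 h2.symm
  · have := kap_sub_norm (d := d) h
    rw [h2] at this
    linarith

lemma kap_not_pun (k : ℤ) {s : ℝ} (hs : 0 < s) : ((s, kap d k) : W d) ∉ Pun d := by
  rintro ⟨h, _⟩
  dsimp only at h
  linarith

/-- formula for the local model -/
noncomputable def Gfun (b : W d) (k : ℤ) (A : E d →L[ℝ] E d) (x0 : E d) (δ : ℝ) (x : E d) : W d :=
  hc b (cut δ (x - x0)) (1, kap d k + A (x - x0))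

lemma Gfun_not_pun {b : W d} (hb : b.1 < 0) (k : ℤ) {A : E d →L[ℝ] E d} {x0 : E d} {δ : ℝ}
    (h : Valid A x0 δ) (x : E d) : Gfun b k A x0 δ x ∉ Pun d := by
  unfold Gfun
  by_cases hx : x = x0
  · subst hx
    rw [sub_self, cut_zero, hc_zero, map_zero, add_zero]
    exact kap_not_pun k one_pos
  · rcases le_or_gt δ ‖x - x0‖ with h1 | h1
    · rw [cut_far h.pos h1, hc_one]
      rintro ⟨h2, _⟩
      linarith
    · refine Cs_not_pun (hc_Cs hb (cut_nonneg _ _) (cut_le_one _ _) (kap_add_mem_Cs ?_ ?_ 1))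
      · intro h2
        exact hx (sub_eq_zero.1 (h.inj _ h2))
      · exact h.small _ h1.le

lemma Gfun_out (b : W d) (k : ℤ) {A : E d →L[ℝ] E d} {x0 : E d} {δ : ℝ}
    (h : Valid A x0 δ) {x : E d} (hx : Out x) : Gfun b k A x0 δ x = b := by
  unfold Gfun
  rw [cut_far h.pos (far_of_out h.cube hx), hc_one]

lemma Gfun_cont_aux (b : W d) (k : ℤ) {T : Type*} [TopologicalSpace T]
    {A : T → (E d →L[ℝ] E d)} {x0 : T → E d} {δ : T → ℝ}
    (hA : Continuous A) (hx : Continuous x0) (hδ : Continuous δ) (hp : ∀ t, 0 < δ t) :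
    Continuous (fun z : T × E d => Gfun b k (A z.1) (x0 z.1) (δ z.1) z.2) := by
  unfold Gfun cut
  refine (hc_cont b).comp (f := fun z : T × E d => (clam (2 * ‖z.2 - x0 z.1‖ / δ z.1 - 1),
    ((1 : ℝ), kap d k + A z.1 (z.2 - x0 z.1)))) ?_
  refine Continuous.prodMk (clam_cont.comp ?_) (continuous_const.prodMk (continuous_const.add ?_))
  · refine Continuous.sub (Continuous.div ?_ ?_ ?_) continuous_const
    · fun_prop
    · fun_prop
    · intro z; exact (hp z.1).ne'
  · exact (hA.comp continuous_fst).clm_apply (by fun_prop)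

lemma Gfun_cont (b : W d) (k : ℤ) (A : E d →L[ℝ] E d) (x0 : E d) {δ : ℝ} (h : 0 < δ) :
    Continuous (Gfun b k A x0 δ) := by
  have h1 := Gfun_cont_aux b k (T := ℝ) (A := fun _ => A) (x0 := fun _ => x0) (δ := fun _ => δ)
      continuous_const continuous_const continuous_const (fun _ => h)
  have h2 : Continuous (fun x : E d => ((0 : ℝ), x)) := by fun_prop
  have h3 := h1.comp h2
  simpa only [Function.comp_def] using h3

/-- the local model as a loop -/
noncomputable def LM (hb : b.1.1 < 0) (k : ℤ) (A : E d →L[ℝ] E d) (x0 : E d) (δ : ℝ)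
    (h : Valid A x0 δ) : RL b where
  toFun := Gfun b k A x0 δ
  cont := Gfun_cont b.1 k A x0 h.pos
  avoid := Gfun_not_pun hb k h
  bd _ hx := Gfun_out _ k h hx

lemma LM_path (hb : b.1.1 < 0) (k : ℤ) {A : ℝ → (E d →L[ℝ] E d)} {x0 : ℝ → E d} {δ : ℝ → ℝ}
    (hA : Continuous A) (hx : Continuous x0) (hδ : Continuous δ)
    (h : ∀ t, Valid (A t) (x0 t) (δ t)) :
    lc (LM hb k _ _ _ (h 0)) = lc (LM hb k _ _ _ (h 1)) := by
  refine lc_eq_of (fun t x => Gfun b k (A t) (x0 t) (δ t) x)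
    (Gfun_cont_aux b.1 k hA hx hδ (fun t => (h t).pos)) (fun x => rfl) (fun x => rfl) ?_ ?_
  · intro t _ x; exact Gfun_not_pun hb k (h t) x
  · intro t _ x hx; exact Gfun_out _ k (h t) hx

lemma LM_indep (hb : b.1.1 < 0) (k : ℤ) {A : E d →L[ℝ] E d} {x0 x1 : E d} {δ0 δ1 : ℝ}
    (h0 : Valid A x0 δ0) (h1 : Valid A x1 δ1) :
    lc (LM hb k A x0 δ0 h0) = lc (LM hb k A x1 δ1 h1) := by
  have hcc := clam_cont
  have key := LM_path (b := b) hb k (A := fun _ => A)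
    (x0 := fun t => (1 - clam t) • x0 + clam t • x1) (δ := fun t => (1 - clam t) * δ0 + clam t * δ1)
    continuous_const (by fun_prop) (by fun_prop) (by
      intro t
      have c0 := clam_nonneg t
      have c1 := clam_le_one t
      generalize clam t = c at *
      have p0 := h0.pos
      have p1 := h1.pos
      refine ⟨?_, h0.inj, ?_, ?_⟩
      · rcases c0.eq_or_lt with h | h
        · subst h; simpa using p0
        · have : 0 ≤ (1 - c) * δ0 := mul_nonneg (by linarith) p0.le
          have : 0 < c * δ1 := mul_pos h p1
          linarith
      · intro z hz
        rcases le_total δ0 δ1 with h | h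
        · apply h1.small; nlinarith
        · apply h0.small; nlinarith
      · intro i
        have a0 := h0.cube i
        have a1 := h1.cube i
        simp only [Pi.add_apply, Pi.smul_apply, smul_eq_mul]
        constructor <;> nlinarith)
  have e0 : LM hb k A x0 δ0 h0 = LM hb k _ _ _ ((by simpa using h0 :
    Valid A ((1 - clam 0) • x0 + clam 0 • x1) ((1 - clam 0) * δ0 + clam 0 * δ1))) := by
    ext1 x; simp [LM]
  have e1 : LM hb k A x1 δ1 h1 = LM hb k _ _ _ ((by simpa using h1 :
    Valid A ((1 - clam 1) • x0 + clam 1 • x1) ((1 - clam 1) * δ0 + clam 1 * δ1))) := by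
    ext1 x; simp [LM]
  rw [e0, e1]
  exact key

/-- standard radius -/
noncomputable def dl (A : E d →L[ℝ] E d) : ℝ := min (1/4) (1 / (2 * (‖A‖ + 1)))

/-- center of the cube -/
noncomputable def cen (d : ℕ) : E d := fun _ => 1/2

lemma valid_dl {A : E d →L[ℝ] E d} (hA : ∀ z, A z = 0 → z = 0) {δ : ℝ} (h0 : 0 < δ)
    (h1 : δ ≤ dl A) : Valid A (cen d) δ := by
  have hn : 0 ≤ ‖A‖ := norm_nonneg A
  refine ⟨h0, hA, ?_, ?_⟩
  · intro z hz
    have h2 : δ ≤ 1 / (2 * (‖A‖ + 1)) := h1.trans (min_le_right _ _)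
    rw [le_div_iff₀ (by positivity)] at h2
    have h3 := A.le_opNorm z
    have h4 : ‖A‖ * ‖z‖ ≤ ‖A‖ * δ := by gcongr
    nlinarith
  · intro i
    have h2 : δ ≤ 1/4 := h1.trans (min_le_left _ _)
    unfold cen
    constructor <;> linarith

lemma dl_pos (A : E d →L[ℝ] E d) : 0 < dl A := by
  have hn : 0 ≤ ‖A‖ := norm_nonneg A
  unfold dl; positivity

/-- class of the standard local model with linear part `A` -/
noncomputable def gam (hb : b.1.1 < 0) (k : ℤ) (A : E d →L[ℝ] E d) (hA : ∀ z, A z = 0 → z = 0) :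
    HomotopyGroup (Fin (d + 1)) (Ym d) b :=
  lc (LM hb k A (cen d) (dl A) (valid_dl hA (dl_pos A) le_rfl))

lemma gam_path (hb : b.1.1 < 0) (k : ℤ) {A : ℝ → (E d →L[ℝ] E d)} (hA : Continuous A)
    (h : ∀ t z, A t z = 0 → z = 0) : gam hb k (A 0) (h 0) = gam hb k (A 1) (h 1) := by
  refine LM_path hb k (δ := fun t => dl (A t)) (x0 := fun _ => cen d) hA continuous_const ?_
    (fun t => valid_dl (h t) (dl_pos _) le_rfl)
  unfold dl
  refine Continuous.min continuous_const (Continuous.div continuous_const (by fun_prop) ?_)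
  intro t
  have hn : 0 ≤ ‖A t‖ := norm_nonneg _
  positivity

/-- reflection in a coordinate -/
noncomputable def refl (d : ℕ) (i : Fin (d + 1)) : E d →L[ℝ] E d :=
  ContinuousLinearMap.pi (fun j => if j = i then -ContinuousLinearMap.proj (R := ℝ) (φ := fun _ => ℝ) j else ContinuousLinearMap.proj j)

lemma refl_apply (i j : Fin (d + 1)) (z : E d) : refl d i z j = if j = i then - z j else z j := by
  unfold refl
  simp only [ContinuousLinearMap.coe_pi']
  split_ifs <;> simp

lemma refl_norm (i : Fin (d + 1)) (z : E d) : ‖refl d i z‖ = ‖z‖ := by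
  simp only [Pi.norm_def]
  congr 2
  funext j
  rw [refl_apply]
  split_ifs <;> simp

lemma gam_refl (hb : b.1.1 < 0) (k : ℤ) {A : E d →L[ℝ] E d} (hA : ∀ z, A z = 0 → z = 0)
    (i : Fin (d + 1)) (hA' : ∀ z, (A ∘L refl d i) z = 0 → z = 0) :
    gam hb k (A ∘L refl d i) hA' = (gam hb k A hA)⁻¹ := by
  set δ := min (dl A) (dl (A ∘L refl d i)) with hδ
  have hp : 0 < δ := lt_min (dl_pos _) (dl_pos _)
  have v1 := valid_dl hA hp (min_le_left _ _)
  have v2 := valid_dl hA' hp (min_le_right _ _)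
  unfold gam
  rw [LM_indep hb k _ v1, LM_indep hb k _ v2]
  apply lc_inv i
  intro x
  simp only [LM, Gfun]
  have : Function.update x i (1 - x i) - cen d = refl d i (x - cen d) := by
    funext j
    rw [refl_apply]
    by_cases h : j = i
    · subst h; simp [cen]; ring
    · simp [h]
  rw [this]
  have h2 : cut δ (refl d i (x - cen d)) = cut δ (x - cen d) := by
    unfold cut; rw [refl_norm]
  rw [h2]
  rfl

end CP

namespace CP
open scoped Topology Topology.Homotopy unitInterval
open Set
variable {d : ℕ} {b : Ym d}

/-- matrices as continuous linear maps -/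
noncomputable def mclm (M : Matrix (Fin (d + 1)) (Fin (d + 1)) ℝ) : E d →L[ℝ] E d :=
  LinearMap.toContinuousLinearMap (Matrix.toLin' M)

lemma mclm_apply (M : Matrix (Fin (d + 1)) (Fin (d + 1)) ℝ) (z : E d) : mclm M z = M.mulVec z := by
  simp [mclm]

lemma mclm_cont : Continuous (mclm : Matrix (Fin (d + 1)) (Fin (d + 1)) ℝ → _) := by
  let L : Matrix (Fin (d + 1)) (Fin (d + 1)) ℝ →ₗ[ℝ] (E d →L[ℝ] E d) :=
    (LinearMap.toContinuousLinearMap (𝕜 := ℝ) (E := E d) (F' := E d)).toLinearMap ∘ₗ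
      (Matrix.toLin' (R := ℝ) (m := Fin (d + 1)) (n := Fin (d + 1))).toLinearMap
  exact L.continuous_of_finiteDimensional

lemma mclm_inj {M : Matrix (Fin (d + 1)) (Fin (d + 1)) ℝ} (h : M.det ≠ 0) (z : E d)
    (hz : mclm M z = 0) : z = 0 := by
  rw [mclm_apply] at hz
  exact Matrix.eq_zero_of_mulVec_eq_zero h hz

lemma exists_matrix (A : E d →L[ℝ] E d) (hA : ∀ z, A z = 0 → z = 0) :
    ∃ M : Matrix (Fin (d + 1)) (Fin (d + 1)) ℝ, M.det ≠ 0 ∧ mclm M = A := by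
  refine ⟨LinearMap.toMatrix' (A : E d →ₗ[ℝ] E d), ?_, ?_⟩
  · rw [LinearMap.det_toMatrix']
    have : Function.Injective (A : E d →ₗ[ℝ] E d) := by
      rw [injective_iff_map_eq_zero]; exact hA
    have h2 : IsUnit (A : E d →ₗ[ℝ] E d) := by
      rw [LinearMap.isUnit_iff_ker_eq_bot]; exact LinearMap.ker_eq_bot.2 this
    exact (LinearMap.isUnit_iff_isUnit_det _ |>.1 h2).ne_zero
  · ext1 z
    rw [mclm_apply, LinearMap.toMatrix'_mulVec]
    rfl

/-- there is a path of invertible matrices to a diagonal sign matrix -/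
def PathTo (M : Matrix (Fin (d + 1)) (Fin (d + 1)) ℝ) : Prop :=
  ∃ p : ℝ → Matrix (Fin (d + 1)) (Fin (d + 1)) ℝ, Continuous p ∧ (∀ t, (p t).det ≠ 0) ∧ p 0 = M ∧
    ∃ ε : Fin (d + 1) → ℝ, (∀ i, ε i = 1 ∨ ε i = -1) ∧ p 1 = Matrix.diagonal ε

lemma pathTo_all (M : Matrix (Fin (d + 1)) (Fin (d + 1)) ℝ) (hM : M.det ≠ 0) : PathTo M := by
  have hcc := clam_cont
  refine Matrix.diagonal_transvection_induction_of_det_ne_zero PathTo M hM ?_ ?_ ?_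
  · intro D hD
    have hD' : ∀ i, D i ≠ 0 := by
      rw [Matrix.det_diagonal] at hD
      intro i
      exact Finset.prod_ne_zero_iff.1 hD i (Finset.mem_univ i)
    refine ⟨fun t => Matrix.diagonal (fun i => (1 - clam t) * D i + clam t * (if 0 < D i then 1 else -1)),
      ?_, ?_, ?_, fun i => if 0 < D i then 1 else -1, ?_, ?_⟩
    · apply Continuous.matrix_diagonal
      fun_prop
    · intro t
      rw [Matrix.det_diagonal]
      refine Finset.prod_ne_zero_iff.2 fun i _ => ?_
      have c0 := clam_nonneg t
      have c1 := clam_le_one t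
      generalize clam t = c at *
      rcases lt_or_gt_of_ne (hD' i) with h | h
      · rw [if_neg (by linarith)]
        apply ne_of_lt
        rcases c0.eq_or_lt with h' | h'
        · subst h'; simpa using h
        · nlinarith [mul_nonneg (sub_nonneg.2 c1) (neg_nonneg.2 h.le)]
      · rw [if_pos h]
        apply ne_of_gt
        rcases c0.eq_or_lt with h' | h'
        · subst h'; simpa using h
        · nlinarith [mul_nonneg (sub_nonneg.2 c1) h.le]
    · simp
    · intro i; dsimp only; split_ifs <;> simp
    · simp
  · intro T
    refine ⟨fun t => Matrix.transvection T.i T.j ((1 - t) * T.c), ?_, ?_, ?_, fun _ => 1, ?_, ?_⟩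
    · unfold Matrix.transvection
      refine continuous_const.add ?_
      refine continuous_matrix fun i j => ?_
      simp only [Matrix.single, Matrix.of_apply]
      split_ifs <;> fun_prop
    · intro t
      rw [Matrix.det_transvection_of_ne _ _ T.hij]; exact one_ne_zero
    · simp [Matrix.TransvectionStruct.toMatrix]
    · intro i; simp
    · simp
  · rintro A B _ _ ⟨p, pc, pd, p0, ε, hε, p1⟩ ⟨q, qc, qd, q0, ε', hε', q1⟩
    refine ⟨fun t => p t * q t, pc.matrix_mul qc, ?_, ?_, fun i => ε i * ε' i, ?_, ?_⟩
    · intro t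
      rw [Matrix.det_mul]; exact mul_ne_zero (pd t) (qd t)
    · simp [p0, q0]
    · intro i
      rcases hε i with h | h <;> rcases hε' i with h' | h' <;> simp [h, h']
    · simp [p1, q1]

lemma gam_congr (hb : b.1.1 < 0) (k : ℤ) {A B : E d →L[ℝ] E d} (h : A = B)
    (hA : ∀ z, A z = 0 → z = 0) (hB : ∀ z, B z = 0 → z = 0) :
    gam hb k A hA = gam hb k B hB := by subst h; rfl

/-- the generators -/
noncomputable def gen (hb : b.1.1 < 0) (k : ℤ) : HomotopyGroup (Fin (d + 1)) (Ym d) b :=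
  gam hb k (ContinuousLinearMap.id ℝ (E d)) (fun _ h => h)

lemma gam_sign (hb : b.1.1 < 0) (k : ℤ) (S : Finset (Fin (d + 1))) : ∀ A : E d →L[ℝ] E d,
    (A = mclm (Matrix.diagonal (fun i => if i ∈ S then (-1 : ℝ) else 1))) → ∀ hA,
    gam hb k A hA ∈ Subgroup.closure (Set.range (gen hb : ℤ → HomotopyGroup (Fin (d + 1)) (Ym d) b)) := by
  induction S using Finset.induction_on with
  | empty =>
    intro A hAe hA
    have : A = ContinuousLinearMap.id ℝ (E d) := by
      rw [hAe]; ext1 z; simp [mclm_apply]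
    rw [gam_congr hb k this hA (fun _ h => h)]
    exact Subgroup.subset_closure ⟨k, rfl⟩
  | insert i S hi ih =>
    intro A hAe hA
    set B := mclm (Matrix.diagonal (fun i => if i ∈ S then (-1 : ℝ) else 1)) with hB
    have hAB : A = B ∘L refl d i := by
      rw [hAe, hB]
      ext z j
      simp only [mclm_apply, ContinuousLinearMap.comp_apply, Matrix.mulVec_diagonal, refl_apply,
        Finset.mem_insert]
      by_cases h : j = i
      · subst h; simp [hi]
      · simp [h]
    have hB' : ∀ z, B z = 0 → z = 0 := by
      apply mclm_inj
      rw [Matrix.det_diagonal]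
      refine Finset.prod_ne_zero_iff.2 fun i _ => ?_
      split_ifs <;> norm_num
    rw [gam_congr hb k hAB hA (fun z hz => hA z (by rw [hAB]; exact hz)), gam_refl hb k hB']
    exact Subgroup.inv_mem _ (ih B rfl hB')

lemma gam_mem (hb : b.1.1 < 0) (k : ℤ) (A : E d →L[ℝ] E d) (hA : ∀ z, A z = 0 → z = 0) :
    gam hb k A hA ∈ Subgroup.closure (Set.range (gen hb : ℤ → HomotopyGroup (Fin (d + 1)) (Ym d) b)) := by
  obtain ⟨M, hM, rfl⟩ := exists_matrix A hA
  obtain ⟨p, pc, pd, p0, ε, hε, p1⟩ := pathTo_all M hM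
  have h := gam_path (b := b) hb k (A := fun t => mclm (p t)) (mclm_cont.comp pc)
    (fun t => mclm_inj (pd t))
  rw [gam_congr hb k (congrArg mclm p0.symm) hA (mclm_inj (pd 0)), h]
  apply gam_sign hb k (Finset.univ.filter (fun i => ε i = -1))
  rw [p1]
  congr 2
  funext i
  rcases hε i with h | h
  · simp only [Finset.mem_filter, Finset.mem_univ, true_and, h]; norm_num
  · simp [h]

end CP

namespace CP
open scoped Topology Topology.Homotopy unitInterval
open Set
variable {d : ℕ} {b : Ym d}

/-- transversality at a bad point -/
def RL.Nice (f : RL b) (x0 : E d) : Prop :=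
  ∃ A : E d →L[ℝ] E d, HasFDerivAt (fun x => (f x).2) A x0 ∧ ∀ z, A z = 0 → z = 0

lemma exists_lower (A : E d →L[ℝ] E d) (hA : ∀ z, A z = 0 → z = 0) :
    ∃ c : ℝ, 0 < c ∧ ∀ z, c * ‖z‖ ≤ ‖A z‖ := by
  have hk : LinearMap.ker (A : E d →ₗ[ℝ] E d) = ⊥ := by
    rw [LinearMap.ker_eq_bot, injective_iff_map_eq_zero]; exact hA
  obtain ⟨K, hK, h⟩ := LinearMap.exists_antilipschitzWith (A : E d →ₗ[ℝ] E d) hk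
  have hK' : (0 : ℝ) < K := by exact_mod_cast hK
  refine ⟨1 / K, by positivity, fun z => ?_⟩
  have h2 := h.le_mul_dist z 0
  simp only [dist_zero_right, map_zero] at h2
  rw [div_mul_eq_mul_div, one_mul, div_le_iff₀ hK', mul_comm]
  simpa using h2

lemma single_mem (hb : b.1.1 < 0) (f : RL b) (x0 : E d) (hbad : f.bad = {x0}) (hn : f.Nice x0) :
    lc f ∈ Subgroup.closure (Set.range (gen hb : ℤ → HomotopyGroup (Fin (d + 1)) (Ym d) b)) := by
  obtain ⟨A, hA, hinj⟩ := hn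
  have hx0 : x0 ∈ f.bad := by rw [hbad]; rfl
  have hout := bad_not_out hb f hx0
  obtain ⟨k, hk, hpos⟩ := hx0
  obtain ⟨c, hc0, hc1⟩ := exists_lower A hinj
  have hlo : ∀ᶠ x in 𝓝 x0, ‖(f x).2 - (f x0).2 - A (x - x0)‖ ≤ (c / 2) * ‖x - x0‖ :=
    (hasFDerivAt_iff_isLittleO.1 hA).def (by positivity)
  obtain ⟨ε, hε, hball⟩ := Metric.eventually_nhds_iff.1 hlo
  have hcube : ∀ᶠ δ in 𝓝[>] (0 : ℝ), ∀ i, δ ≤ x0 i ∧ x0 i ≤ 1 - δ := by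
    rw [Filter.eventually_all]
    intro i
    simp only [Out, not_exists, not_or, not_le] at hout
    have := hout i
    have h3 : ∀ᶠ δ in 𝓝 (0 : ℝ), δ < x0 i := eventually_lt_nhds this.1
    have h4 : ∀ᶠ δ in 𝓝 (0 : ℝ), δ < 1 - x0 i := eventually_lt_nhds (by linarith)
    filter_upwards [nhdsWithin_le_nhds h3, nhdsWithin_le_nhds h4] with δ a1 a2
    constructor <;> linarith
  have h5 : ∀ᶠ δ in 𝓝[>] (0 : ℝ), δ < ε := nhdsWithin_le_nhds (eventually_lt_nhds hε)
  have h6 : ∀ᶠ δ in 𝓝[>] (0 : ℝ), δ < 1 / (2 * (‖A‖ + 1)) :=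
    nhdsWithin_le_nhds (eventually_lt_nhds (by positivity))
  have h7 : ∀ᶠ δ in 𝓝[>] (0 : ℝ), δ < 1 / c := nhdsWithin_le_nhds (eventually_lt_nhds (by positivity))
  obtain ⟨δ, hδp, q1, q2, q3, q4⟩ :=
    ((eventually_mem_nhdsWithin (a := (0 : ℝ)) (s := Ioi 0)).and (hcube.and (h5.and (h6.and h7)))).exists
  have hδ0 : 0 < δ := hδp
  have hAn : 0 ≤ ‖A‖ := norm_nonneg A
  have hAz : ∀ z : E d, ‖z‖ ≤ δ → ‖A z‖ < 1 / 2 := by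
    intro z hz
    rw [lt_div_iff₀ (by positivity)] at q3
    have h3 := A.le_opNorm z
    have h4 : ‖A‖ * ‖z‖ ≤ ‖A‖ * δ := by gcongr
    nlinarith
  have hv : Valid A x0 δ := ⟨hδ0, hinj, fun z hz => (hAz z hz).trans (by norm_num), q1⟩
  have hcont : Continuous (fun x : E d => cut δ (x - x0)) := by
    unfold cut
    exact clam_cont.comp (by fun_prop)
  have hz : ∀ x ∈ f.bad, cut δ (x - x0) = 0 := by
    intro x hx
    rw [hbad] at hx
    rw [hx, sub_self, cut_zero]
  have e1 := lc_push hb f (fun x => cut δ (x - x0)) hcont (fun x => cut_nonneg _ _)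
    (fun x => cut_le_one _ _) hz
  have e2 : lc (f.push hb (fun x => cut δ (x - x0)) hcont (fun x => cut_nonneg _ _)
    (fun x => cut_le_one _ _) hz) = lc (LM hb k A x0 δ hv) := by
    refine lc_eq_of (fun t x => hc b (cut δ (x - x0))
      ((1 - t) • f x + t • ((1 : ℝ), kap d k + A (x - x0)))) ?_ ?_ ?_ ?_ ?_
    · have := f.cont
      exact (hc_cont b.1).comp (f := fun z : ℝ × E d => (cut δ (z.2 - x0),
        (1 - z.1) • f z.2 + z.1 • ((1 : ℝ), kap d k + A (z.2 - x0))))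
        ((hcont.comp continuous_snd).prodMk (by fun_prop))
    · intro x; simp [RL.push]
    · intro x; simp [LM, Gfun]
    · intro t ht x
      rcases le_or_gt δ ‖x - x0‖ with h1 | h1
      · rw [cut_far hδ0 h1, hc_one]
        exact b.2
      by_cases hx : x = x0
      · subst hx
        rw [sub_self, cut_zero, hc_zero, map_zero, add_zero]
        rintro ⟨h2, _⟩
        simp only [Prod.fst_add, Prod.smul_fst, smul_eq_mul, mul_one] at h2
        rcases ht.1.eq_or_lt with h3 | h3
        · subst h3; simp at h2; linarith
        · nlinarith [mul_nonneg (sub_nonneg.2 ht.2) hpos.le]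
      · set z := x - x0 with hzdef
        have hz0 : z ≠ 0 := sub_ne_zero.2 hx
        have hznorm : 0 < ‖z‖ := norm_pos_iff.2 hz0
        have herr := hball (y := x) (by rw [dist_eq_norm]; linarith)
        set r := (f x).2 - (f x0).2 - A z with hr
        have hval : (1 - t) • f x + t • ((1 : ℝ), kap d k + A z) =
            ((1 - t) * (f x).1 + t, kap d k + (A z + (1 - t) • r)) := by
          ext1
          · simp
          · simp only [Prod.snd_add, Prod.smul_snd]
            rw [hr, hk]
            module
        rw [hval]
        have hr1 : ‖(1 - t) • r‖ ≤ c / 2 * ‖z‖ := by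
          rw [norm_smul]
          have : ‖(1 - t : ℝ)‖ ≤ 1 := by
            rw [Real.norm_eq_abs, abs_le]; constructor <;> linarith [ht.1, ht.2]
          calc ‖(1 - t : ℝ)‖ * ‖r‖ ≤ 1 * ‖r‖ := by gcongr
            _ ≤ _ := by rw [one_mul]; exact herr
        refine Cs_not_pun (hc_Cs hb (cut_nonneg _ _) (cut_le_one _ _) (kap_add_mem_Cs ?_ ?_ _))
        · intro h0
          have : A z = -((1 - t) • r) := eq_neg_of_add_eq_zero_left h0
          have h8 := hc1 z
          rw [this, norm_neg] at h8
          nlinarith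
        · have h9 := norm_add_le (A z) ((1 - t) • r)
          have h10 := hAz z h1.le
          have h11 : c / 2 * ‖z‖ ≤ 1 / 2 := by
            rw [lt_div_iff₀ hc0] at q4
            nlinarith
          linarith
    · intro t _ x hx
      rw [cut_far hδ0 (far_of_out q1 hx), hc_one]
  rw [← e1, e2]
  rw [LM_indep hb k hv (valid_dl hinj (dl_pos A) le_rfl)]
  exact gam_mem hb k A hinj

open Function in
/-- restrict to the left half -/
def RL.left (f : RL b) (i : Fin (d + 1)) (c : ℝ) (_hc : c ≤ 1)
    (hz : ∀ x : E d, x i = c → f x = b) : RL b where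
  toFun x := f (update x i (min (x i) c))
  cont := f.cont.comp (continuous_id.update i (by fun_prop))
  avoid x := f.avoid _
  bd x hx := by
    rcases le_total (x i) c with h | h
    · rw [min_eq_left h, update_eq_self, f.bd x hx]
    · exact hz _ (by simp [h])

open Function in
/-- restrict to the right half -/
def RL.right (f : RL b) (i : Fin (d + 1)) (c : ℝ) (_hc : 0 ≤ c)
    (hz : ∀ x : E d, x i = c → f x = b) : RL b where
  toFun x := f (update x i (max (x i) c))
  cont := f.cont.comp (continuous_id.update i (by fun_prop))
  avoid x := f.avoid _
  bd x hx := by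
    rcases le_total c (x i) with h | h
    · rw [max_eq_left h, update_eq_self, f.bd x hx]
    · exact hz _ (by simp [h])

open Function in
lemma lc_split (f : RL b) (i : Fin (d + 1)) (c : ℝ) (hc0 : 0 ≤ c) (hc1 : c ≤ 1)
    (hz : ∀ x : E d, x i = c → f x = b) :
    lc f = lc (f.right i c hc0 hz) * lc (f.left i c hc1 hz) := by
  rw [← lc_trans i]
  set fL := f.left i c hc1 hz with hfL
  set fR := f.right i c hc0 hz with hfR
  have hL : ∀ x : E d, c ≤ x i → fL x = b := fun x h => hz _ (by simp [h])
  have hR : ∀ x : E d, x i ≤ c → fR x = b := fun x h => hz _ (by simp [h])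
  refine lc_eq_of (fun t x => fL (update x i ((1 + t) * x i)) + fR (update x i ((1 + t) * x i - t)) - b)
    ?_ ?_ ?_ ?_ ?_
  · have h1 := fL.cont
    have h2 := fR.cont
    refine ((h1.comp ?_).add (h2.comp ?_)).sub continuous_const
    · exact continuous_snd.update i (by fun_prop)
    · exact continuous_snd.update i (by fun_prop)
  · intro x
    simp only [add_zero, one_mul, sub_zero, update_eq_self]
    rcases le_total c (x i) with h | h
    · rw [hL x h]
      simp [hfR, RL.right, h]
    · rw [hR x h]
      simp [hfL, RL.left, h]
  · intro x
    simp only [RL.trans]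
    norm_num
  · intro t ht x
    rcases le_total c ((1 + t) * x i) with h | h
    · rw [hL _ (by simpa using h)]
      simpa using fR.avoid _
    · rw [hR _ (by simp; linarith [ht.1])]
      simpa using fL.avoid _
  · intro t ht x hx
    have h1 : Out (update x i ((1 + t) * x i)) := by
      obtain ⟨j, hj⟩ := hx
      refine ⟨j, ?_⟩
      by_cases h : j = i
      · subst h; simp only [update_self]; rcases hj with hj | hj
        · left; nlinarith [ht.1]
        · right; nlinarith [ht.1]
      · simpa [h] using hj
    have h2 : Out (update x i ((1 + t) * x i - t)) := by
      obtain ⟨j, hj⟩ := hx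
      refine ⟨j, ?_⟩
      by_cases h : j = i
      · subst h; simp only [update_self]; rcases hj with hj | hj
        · left; nlinarith [ht.1]
        · right; nlinarith [ht.1]
      · simpa [h] using hj
    rw [fL.bd _ h1, fR.bd _ h2]; simp

lemma nice_congr {f g : RL b} {x : E d} (h : f.Nice x) (he : ∀ᶠ z in 𝓝 x, g z = f z) : g.Nice x := by
  obtain ⟨A, hA, hi⟩ := h
  refine ⟨A, hA.congr_of_eventuallyEq ?_, hi⟩
  filter_upwards [he] with z hz
  rw [hz]

lemma finite_nice_mem (hb : b.1.1 < 0) (n : ℕ) : ∀ (f : RL b), f.bad.Finite → f.bad.ncard = n →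
    (∀ x ∈ f.bad, f.Nice x) →
    lc f ∈ Subgroup.closure (Set.range (gen hb : ℤ → HomotopyGroup (Fin (d + 1)) (Ym d) b)) := by
  induction n using Nat.strong_induction_on with
  | _ n ih =>
  intro f hfin hcard hnice
  rcases Nat.lt_or_ge n 2 with hn | hn
  · interval_cases n
    · rw [Set.ncard_eq_zero hfin] at hcard
      have hz : ∀ x ∈ f.bad, (fun _ : E d => (1 : ℝ)) x = 0 := by
        intro x hx; rw [hcard] at hx; exact absurd hx (by simp)
      have e := lc_push hb f (fun _ => 1) continuous_const (fun _ => zero_le_one)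
        (fun _ => le_rfl) hz
      have e2 : f.push hb (fun _ => 1) continuous_const (fun _ => zero_le_one)
        (fun _ => le_rfl) hz = RL.const b := by
        ext1 x; simp [RL.push, hc_one, RL.const]
      rw [← e, e2, lc_const]
      exact Subgroup.one_mem _
    · obtain ⟨x0, hx0⟩ := Set.ncard_eq_one.1 hcard
      exact single_mem hb f x0 hx0 (hnice x0 (by rw [hx0]; rfl))
  · obtain ⟨x, y, hx, hy, hxy⟩ := (Set.one_lt_ncard_iff hfin).1 (by omega)
    obtain ⟨i, hi⟩ := Function.ne_iff.1 hxy
    wlog hlt : x i < y i generalizing x y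
    · exact this y x hy hx hxy.symm hi.symm (lt_of_le_of_ne (not_lt.1 hlt) hi.symm)
    -- choose the separating level
    have hfin2 : ((fun z : E d => z i) '' f.bad).Finite := hfin.image _
    obtain ⟨c, hc, hcn⟩ := ((Set.Ioo_infinite hlt).sdiff hfin2).nonempty
    have hox := bad_not_out hb f hx
    have hoy := bad_not_out hb f hy
    simp only [Out, not_exists, not_or, not_le] at hox hoy
    have hc0 : 0 ≤ c := (hox i).1.le.trans hc.1.le
    have hc1 : c ≤ 1 := hc.2.le.trans (hoy i).2.le
    have hev : ∀ᶠ δ in 𝓝[>] (0 : ℝ), ∀ z ∈ f.bad, δ < |z i - c| := by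
      rw [Filter.eventually_all_finite hfin]
      intro z hz
      have : 0 < |z i - c| := by
        rw [abs_pos, sub_ne_zero]
        intro h
        exact hcn ⟨z, hz, h⟩
      exact nhdsWithin_le_nhds (eventually_lt_nhds this)
    obtain ⟨δ, hδp, hδ⟩ :=
      ((eventually_mem_nhdsWithin (a := (0 : ℝ)) (s := Ioi 0)).and hev).exists
    have hδ0 : 0 < δ := hδp
    set χ : E d → ℝ := fun z => clam (1 - |z i - c| / δ) with hχ
    have hχz : ∀ z : E d, δ < |z i - c| → χ z = 0 := by
      intro z hz
      apply clam_of_nonpos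
      have : 1 ≤ |z i - c| / δ := by rw [le_div_iff₀ hδ0]; linarith
      linarith
    have hχc : Continuous χ := clam_cont.comp (by fun_prop)
    have e := lc_push hb f χ hχc (fun _ => clam_nonneg _) (fun _ => clam_le_one _)
      (fun z hz => hχz z (hδ z hz))
    have hbp := bad_push hb f χ hχc (fun _ => clam_nonneg _) (fun _ => clam_le_one _)
      (fun z hz => hχz z (hδ z hz))
    set f' := f.push hb χ hχc (fun _ => clam_nonneg _) (fun _ => clam_le_one _)
      (fun z hz => hχz z (hδ z hz)) with hf'
    have hloc : ∀ z ∈ f.bad, ∀ᶠ w in 𝓝 z, f' w = f w := by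
      intro z hz
      have hcont : Continuous (fun w : E d => |w i - c|) := by fun_prop
      have : ∀ᶠ w in 𝓝 z, δ < |w i - c| :=
        hcont.continuousAt.eventually (p := fun r => δ < r) (lt_mem_nhds (hδ z hz))
      filter_upwards [this] with w hw
      simp [hf', RL.push, hχz w hw, hc_zero]
    have hzero : ∀ z : E d, z i = c → f' z = b := by
      intro z hz
      simp [hf', RL.push, hχ, hz, hc_one]
    have hbl : (f'.left i c hc1 hzero).bad ⊆ f.bad \ {y} := by
      intro z hz
      have hlt' : z i < c := by
        by_contra h
        push Not at h
        obtain ⟨k, _, h2⟩ := hz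
        have : f'.left i c hc1 hzero z = b := hzero _ (by simp [h])
        rw [this] at h2; linarith
      have : f'.left i c hc1 hzero z = f' z := by simp [RL.left, hlt'.le]
      refine ⟨?_, ?_⟩
      · rw [← hbp]
        obtain ⟨k, hk⟩ := hz
        exact ⟨k, by rwa [← this]⟩
      · rintro rfl
        exact absurd hc.2 (not_lt.2 hlt'.le)
    have hbr : (f'.right i c hc0 hzero).bad ⊆ f.bad \ {x} := by
      intro z hz
      have hlt' : c < z i := by
        by_contra h
        push Not at h
        obtain ⟨k, _, h2⟩ := hz
        have : f'.right i c hc0 hzero z = b := hzero _ (by simp [h])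
        rw [this] at h2; linarith
      have : f'.right i c hc0 hzero z = f' z := by simp [RL.right, hlt'.le]
      refine ⟨?_, ?_⟩
      · rw [← hbp]
        obtain ⟨k, hk⟩ := hz
        exact ⟨k, by rwa [← this]⟩
      · rintro rfl
        exact absurd hc.1 (not_lt.2 hlt'.le)
    rw [← e, lc_split f' i c hc0 hc1 hzero]
    refine Subgroup.mul_mem _ ?_ ?_
    · refine ih _ ?_ _ (hfin.subset (hbr.trans sdiff_subset)) rfl ?_
      · rw [← hcard]
        refine Set.ncard_lt_ncard ⟨hbr.trans sdiff_subset, fun h => ?_⟩ hfin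
        exact (hbr (h hx)).2 rfl
      · intro z hz
        have hzb := (hbr hz).1
        have hlt' : c < z i := by
          by_contra h
          push Not at h
          obtain ⟨k, _, h2⟩ := hz
          have : f'.right i c hc0 hzero z = b := hzero _ (by simp [h])
          rw [this] at h2; linarith
        refine nice_congr (hnice z hzb) ?_
        have : ∀ᶠ w in 𝓝 z, c < w i :=
          IsOpen.mem_nhds (isOpen_lt continuous_const (continuous_apply i)) hlt'
        filter_upwards [this, hloc z hzb] with w h1 h2
        rw [← h2]; simp [RL.right, h1.le]
    · refine ih _ ?_ _ (hfin.subset (hbl.trans sdiff_subset)) rfl ?_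
      · rw [← hcard]
        refine Set.ncard_lt_ncard ⟨hbl.trans sdiff_subset, fun h => ?_⟩ hfin
        exact (hbl (h hy)).2 rfl
      · intro z hz
        have hzb := (hbl hz).1
        have hlt' : z i < c := by
          by_contra h
          push Not at h
          obtain ⟨k, _, h2⟩ := hz
          have : f'.left i c hc1 hzero z = b := hzero _ (by simp [h])
          rw [this] at h2; linarith
        refine nice_congr (hnice z hzb) ?_
        have : ∀ᶠ w in 𝓝 z, w i < c :=
          IsOpen.mem_nhds (isOpen_lt (continuous_apply i) continuous_const) hlt'
        filter_upwards [this, hloc z hzb] with w h1 h2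
        rw [← h2]; simp [RL.left, h1.le]

end CP

namespace CP
open scoped Topology Topology.Homotopy unitInterval
open Set
variable {d : ℕ} {b : Ym d}

lemma isClosed_range_kap : IsClosed {v : E d | ∃ k : ℤ, v = kap d k} := by
  have h : {v : E d | ∃ k : ℤ, v = kap d k} =
      (fun v : E d => (v 0, v - Pi.single 0 (v 0))) ⁻¹' ((Set.range (Int.cast : ℤ → ℝ)) ×ˢ {0}) := by
    ext v
    simp only [mem_ofPred_eq, mem_preimage, mem_prod, mem_range, mem_singleton_iff, sub_eq_zero]
    constructor
    · rintro ⟨k, rfl⟩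
      refine ⟨⟨k, by simp [kap]⟩, by simp [kap]⟩
    · rintro ⟨⟨k, hk⟩, h2⟩
      exact ⟨k, by rw [h2, ← hk]; rfl⟩
  rw [h]
  refine IsClosed.preimage ?_ (Int.isClosedEmbedding_coe_real.isClosed_range.prod isClosed_singleton)
  refine (continuous_apply 0).prodMk (continuous_id.sub ?_)
  exact (continuous_single 0).comp (continuous_apply 0)

lemma isClosed_Pun : IsClosed (Pun d) := by
  have : Pun d = (fun y : W d => y.1) ⁻¹' {0} ∩ (fun y : W d => y.2) ⁻¹' {v | ∃ k : ℤ, v = kap d k} := rfl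
  rw [this]
  exact (isClosed_singleton.preimage continuous_fst).inter
    (isClosed_range_kap.preimage continuous_snd)

lemma exists_rho_compact {K : Set (W d)} (hK : IsCompact K) (h : ∀ y ∈ K, y ∉ Pun d) :
    ∃ ρ : ℝ, 0 < ρ ∧ ∀ y ∈ K, ∀ p ∈ Pun d, ρ ≤ dist y p := by
  have hd : Disjoint K (Pun d) := Set.disjoint_left.2 h
  obtain ⟨δ, hδ, hdis⟩ := hd.exists_thickenings hK isClosed_Pun
  refine ⟨δ, hδ, fun y hy p hp => ?_⟩
  by_contra hlt
  push Not at hlt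
  have h1 : p ∈ Metric.thickening δ K := Metric.mem_thickening_iff.2 ⟨y, hy, by rwa [dist_comm]⟩
  have h2 : p ∈ Metric.thickening δ (Pun d) := Metric.self_subset_thickening hδ _ hp
  exact Set.disjoint_left.1 hdis h1 h2

lemma RL.range_compact (f : RL b) : IsCompact (Set.range f) := by
  have : Set.range f = Set.range (fun t : Fin (d + 1) → I => f (fun i => (t i : ℝ))) := by
    ext y
    constructor
    · rintro ⟨x, rfl⟩
      exact ⟨clE x, f.coe_clE x⟩
    · rintro ⟨t, rfl⟩; exact ⟨_, rfl⟩
  rw [this]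
  exact isCompact_range (f.cont.comp (by fun_prop))

lemma RL.exists_rho (f : RL b) : ∃ ρ : ℝ, 0 < ρ ∧ ∀ x, ∀ p ∈ Pun d, ρ ≤ dist (f x) p := by
  obtain ⟨ρ, h, h2⟩ := exists_rho_compact f.range_compact (by rintro _ ⟨x, rfl⟩; exact f.avoid x)
  exact ⟨ρ, h, fun x => h2 _ ⟨x, rfl⟩⟩

lemma sard_choice (g : E d → E d) (hg : ContDiff ℝ 1 g) {ε : ℝ} (hε : 0 < ε) :
    ∃ c : E d, ‖c‖ < ε ∧ ∀ x, ∀ k : ℤ, g x + c = kap d k → (fderiv ℝ g x).det ≠ 0 := by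
  set S : Set (E d) := {x | (fderiv ℝ g x).det = 0}
  have h0 : MeasureTheory.volume (g '' S) = 0 := by
    refine MeasureTheory.addHaar_image_eq_zero_of_det_fderivWithin_eq_zero (f' := fun x => fderiv ℝ g x)
      MeasureTheory.volume ?_ (fun x hx => hx)
    intro x _
    exact ((hg.differentiable one_ne_zero) x).hasFDerivAt.hasFDerivWithinAt
  have h1 : MeasureTheory.volume (⋃ k : ℤ, (fun v => kap d k - v) '' (g '' S)) = 0 := by
    rw [MeasureTheory.measure_iUnion_null_iff]
    intro k
    have : (fun v => kap d k - v) '' (g '' S) = (fun v => kap d k - v) ⁻¹' (g '' S) := by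
      ext v
      constructor
      · rintro ⟨u, hu, rfl⟩; simpa using hu
      · intro hv; exact ⟨_, hv, by simp⟩
    rw [this]
    exact ((MeasureTheory.Measure.measurePreserving_sub_left MeasureTheory.volume
      (kap d k)).quasiMeasurePreserving).preimage_null h0
  have h2 : ¬ Metric.ball (0 : E d) ε ⊆ ⋃ k : ℤ, (fun v => kap d k - v) '' (g '' S) := by
    intro hsub
    have := MeasureTheory.measure_mono_null hsub h1
    exact (Metric.measure_ball_pos MeasureTheory.volume (0 : E d) hε).ne' this
  obtain ⟨c, hc, hcn⟩ := Set.not_subset.1 h2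
  refine ⟨c, by simpa using hc, ?_⟩
  intro x k hx hdet
  apply hcn
  refine mem_iUnion.2 ⟨k, g x, ⟨x, hdet, rfl⟩, ?_⟩
  simp [← hx]

lemma exists_nice (hb : b.1.1 < 0) (f : RL b) : ∃ f' : RL b, lc f' = lc f ∧ f'.bad.Finite ∧
    ∀ x ∈ f'.bad, f'.Nice x := by
  obtain ⟨ρ, hρ, hdist⟩ := f.exists_rho
  set β := -b.1.1 with hβ
  have hβ0 : 0 < β := by linarith
  set ε := min (ρ / 4) (β / 8) with hε
  have hε0 : 0 < ε := by positivity
  have hε1 : ε ≤ ρ / 4 := min_le_left _ _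
  have hε2 : ε ≤ β / 8 := min_le_right _ _
  obtain ⟨g, hg, hgf, -⟩ := f.cont.exists_contDiff_approx 1 (ε := fun _ => ε) continuous_const (fun _ => hε0)
  have hg1 : ContDiff ℝ 1 g := hg
  have hg2 : ContDiff ℝ 1 (fun x => (g x).2) := contDiff_snd.comp hg1
  obtain ⟨c, hc, hcs⟩ := sard_choice (fun x => (g x).2) hg2 hε0
  set G : E d → W d := fun x => g x + (0, c) with hG
  have hGc : Continuous G := hg1.continuous.add continuous_const
  have hGd : ∀ x, ‖G x - f x‖ ≤ 2 * ε := by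
    intro x
    have h1 := hgf x
    rw [dist_eq_norm] at h1
    have h2 : ‖((0 : ℝ), c)‖ ≤ ε := by
      rw [Prod.norm_def]; simp; exact hc.le
    have : G x - f x = (g x - f x) + (0, c) := by simp [hG]; abel
    rw [this]
    exact (norm_add_le _ _).trans (by linarith)
  set η := β / 8 with hη
  have hη0 : 0 < η := by positivity
  set χ : E d → ℝ := fun x => clam (‖f x - b‖ / η - 1) with hχ
  have hfc := f.cont
  have hχc : Continuous χ := clam_cont.comp (by fun_prop)
  have hχn : ∀ x t, t ∈ Icc (0:ℝ) 1 → ‖(t * χ x) • (G x - f x)‖ ≤ 2 * ε := by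
    intro x t ht
    rw [norm_smul, Real.norm_eq_abs, abs_of_nonneg (mul_nonneg ht.1 (clam_nonneg _))]
    have := mul_le_one₀ ht.2 (clam_nonneg (‖f x - b‖ / η - 1)) (clam_le_one _)
    calc t * χ x * ‖G x - f x‖ ≤ 1 * ‖G x - f x‖ := by gcongr
      _ ≤ _ := by rw [one_mul]; exact hGd x
  have hav : ∀ x t, t ∈ Icc (0:ℝ) 1 → f x + (t * χ x) • (G x - f x) ∉ Pun d := by
    intro x t ht hp
    have h1 := hdist x _ hp
    rw [dist_eq_norm, sub_add_cancel_left, norm_neg] at h1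
    have := hχn x t ht
    linarith
  have hbd : ∀ x t, Out x → f x + (t * χ x) • (G x - f x) = b := by
    intro x t hx
    have : χ x = 0 := by
      apply clam_of_nonpos; rw [f.bd x hx]; simp
    rw [this, f.bd x hx]; simp
  let f' : RL b := ⟨fun x => f x + (1 * χ x) • (G x - f x), by fun_prop,
    fun x => hav x 1 ⟨zero_le_one, le_rfl⟩, fun x hx => hbd x 1 hx⟩
  have hf'v : ∀ x, f' x = f x + (1 * χ x) • (G x - f x) := fun x => rfl
  have hcls : lc f' = lc f := by
    symm
    refine lc_eq_of (fun t x => f x + (t * χ x) • (G x - f x)) (by fun_prop) (by simp)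
      (fun x => rfl) ?_ ?_
    · intro t ht x; exact hav x t ht
    · intro t _ x hx; exact hbd x t hx
  have hlocal : ∀ x ∈ f'.bad, ∀ᶠ z in 𝓝 x, f' z = G z := by
    rintro x ⟨k, hk, hpos⟩
    have h1 := hχn x 1 ⟨zero_le_one, le_rfl⟩
    have h2 : |((1 * χ x) • (G x - f x)).1| ≤ 2 * ε := (norm_fst_le _).trans h1
    rw [hf'v x, Prod.fst_add] at hpos
    have h3 : (f x).1 > - (2 * ε) := by linarith [le_abs_self ((1 * χ x) • (G x - f x)).1]
    have h4 : |(f x - (b : W d)).1| ≤ ‖f x - (b : W d)‖ := norm_fst_le (f x - (b : W d))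
    have h5 : 2 * η < ‖f x - b‖ := by
      have := le_abs_self (f x - b).1
      rw [Prod.fst_sub] at this h4
      linarith
    have hev : ∀ᶠ z in 𝓝 x, 2 * η < ‖f z - b‖ :=
      IsOpen.mem_nhds (isOpen_lt continuous_const (by fun_prop)) h5
    filter_upwards [hev] with z hz
    have : χ z = 1 := by
      apply clam_of_one_le
      have : 2 ≤ ‖f z - b‖ / η := by rw [le_div_iff₀ hη0]; linarith
      linarith
    rw [hf'v, this]; simp
  have hnice : ∀ x ∈ f'.bad, f'.Nice x := by
    intro x hx
    have hl := hlocal x hx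
    obtain ⟨k, hk, hpos⟩ := hx
    refine ⟨fderiv ℝ (fun x => (g x).2) x, ?_, ?_⟩
    · have h1 : HasFDerivAt (fun x => (g x).2) (fderiv ℝ (fun x => (g x).2) x) x :=
        ((hg2.differentiable one_ne_zero) x).hasFDerivAt
      have h2 := h1.add_const c
      refine h2.congr_of_eventuallyEq ?_
      filter_upwards [hl] with z hz
      rw [hz]; simp [hG]
    · have hdet := hcs x k (by
        have := hl.self_of_nhds
        rw [this] at hk
        simpa [hG] using hk)
      intro z hz
      have : IsUnit (LinearMap.det (fderiv ℝ (fun x => (g x).2) x : E d →ₗ[ℝ] E d)) := isUnit_iff_ne_zero.2 hdet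
      have h3 := (LinearMap.isUnit_iff_isUnit_det _).2 this
      rw [LinearMap.isUnit_iff_ker_eq_bot, LinearMap.ker_eq_bot] at h3
      exact h3 (by simpa using hz)
  refine ⟨f', hcls, ?_, hnice⟩
  -- finiteness
  have hset : f'.bad = {x | 0 ≤ (f' x).1 ∧ (f' x).2 ∈ {v : E d | ∃ k : ℤ, v = kap d k}} := by
    ext x
    constructor
    · rintro ⟨k, hk, hp⟩; exact ⟨hp.le, k, hk⟩
    · rintro ⟨hp, k, hk⟩
      refine ⟨k, hk, lt_of_le_of_ne hp fun h => f'.avoid x ⟨h.symm, k, hk⟩⟩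
  have hclosed : IsClosed f'.bad := by
    rw [hset]
    have := f'.cont
    exact (isClosed_le (f := fun _ : E d => (0 : ℝ)) (g := fun x => (f' x).1) continuous_const
      (by fun_prop)).inter (isClosed_range_kap.preimage (f := fun x : E d => (f' x).2) (by fun_prop))
  have hcomp : IsCompact f'.bad := by
    refine (isCompact_Icc (a := (0 : E d)) (b := 1)).of_isClosed_subset hclosed ?_
    intro x hx
    have := bad_not_out hb f' hx
    simp only [Out, not_exists, not_or, not_le] at this
    exact ⟨fun i => (this i).1.le, fun i => (this i).2.le⟩
  refine hcomp.finite ?_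
  rw [isDiscrete_iff_forall_mem_exists_isOpen]
  intro x hx
  obtain ⟨A, hA, hinj⟩ := hnice x hx
  obtain ⟨c', hc', hlow⟩ := exists_lower A hinj
  have hk := hx
  obtain ⟨k, hk, -⟩ := hk
  have e1 : ∀ᶠ z in 𝓝[≠] x, (f' z).2 ≠ kap d k := by
    refine hA.eventually_ne ⟨(1 / c').toNNReal, ?_⟩
    refine AntilipschitzWith.of_le_mul_dist fun u v => ?_
    rw [dist_eq_norm, dist_eq_norm, ← map_sub]
    have := hlow (u - v)
    rw [Real.coe_toNNReal _ (by positivity)]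
    rw [div_mul_eq_mul_div, one_mul, le_div_iff₀ hc', mul_comm]
    exact this
  have e2 : ∀ᶠ z in 𝓝 x, ‖(f' z).2 - kap d k‖ < 1 := by
    have := f'.cont
    refine IsOpen.mem_nhds (isOpen_lt (by fun_prop) continuous_const) ?_
    simp [hk]
  rw [eventually_nhdsWithin_iff] at e1
  obtain ⟨U, hU, hUo, hxU⟩ := eventually_nhds_iff.1 (e1.and e2)
  refine ⟨U, hUo, ?_⟩
  ext z
  constructor
  · rintro ⟨hzU, j, hj, -⟩
    by_contra hne
    obtain ⟨a1, a2⟩ := hU z hzU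
    by_cases hjk : j = k
    · subst hjk; exact a1 hne hj
    · rw [hj] at a2
      linarith [kap_sub_norm (d := d) hjk]
  · rintro rfl; exact ⟨hxU, hx⟩

lemma closure_gen (hb : b.1.1 < 0) :
    Subgroup.closure (Set.range (gen hb : ℤ → HomotopyGroup (Fin (d + 1)) (Ym d) b)) = ⊤ := by
  rw [eq_top_iff]
  intro a _
  obtain ⟨f, rfl⟩ := lc_surj a
  obtain ⟨f', h1, h2, h3⟩ := exists_nice hb f
  rw [← h1]
  exact finite_nice_mem hb _ f' h2 rfl h3

end CP

namespace CP
open scoped Topology Topology.Homotopy unitInterval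
open Set
variable {d : ℕ} {b : Ym d}

/-- The determinant as a continuous alternating form. -/
noncomputable def detF (d : ℕ) : E d [⋀^Fin (d + 1)]→L[ℝ] ℝ :=
  { (Matrix.detRowAlternating : (Fin (d+1) → ℝ) [⋀^Fin (d+1)]→ₗ[ℝ] ℝ) with
    cont := by
      change Continuous (fun M : Matrix (Fin (d+1)) (Fin (d+1)) ℝ => M.det)
      exact Continuous.matrix_det continuous_id }

lemma detF_apply (v : Fin (d+1) → E d) : detF d v = Matrix.det (Matrix.of v) := rfl

/-- A fixed bump function. -/
noncomputable def bmp (d : ℕ) : ContDiffBump (0 : E d) := ⟨1/2, 1, by norm_num, by norm_num⟩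

/-- The cutoff density near the puncture of index `k`. -/
noncomputable def Ph (k : ℤ) (r : ℝ) (y : W d) : ℝ :=
  bmp d (r⁻¹ • (y.2 - kap d k)) * Real.smoothTransition (y.1 / r)

lemma Ph_contDiff (k : ℤ) (r : ℝ) {n : ℕ∞} : ContDiff ℝ n (Ph (d := d) k r) := by
  unfold Ph
  refine ContDiff.mul ?_ ?_
  · exact (bmp d).contDiff.comp ((contDiff_snd.sub contDiff_const).const_smul _)
  · exact Real.smoothTransition.contDiff.comp (contDiff_fst.div_const _)

lemma Ph_neg {k : ℤ} {r : ℝ} (hr : 0 < r) {y : W d} (h : y.1 ≤ 0) : Ph k r y = 0 := by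
  unfold Ph
  rw [Real.smoothTransition.zero_of_nonpos (div_nonpos_of_nonpos_of_nonneg h hr.le), mul_zero]

lemma bmp_far {r : ℝ} (hr : 0 < r) {v : E d} (h : r ≤ ‖v‖) : bmp d (r⁻¹ • v) = 0 := by
  apply (bmp d).zero_of_le_dist
  rw [dist_zero_right, norm_smul, norm_inv, Real.norm_of_nonneg hr.le]
  change 1 ≤ _
  rw [inv_mul_eq_div, le_div_iff₀ hr, one_mul]
  exact h

lemma Ph_far {k : ℤ} {r : ℝ} (hr : 0 < r) {y : W d} (h : r ≤ ‖y.2 - kap d k‖) : Ph k r y = 0 := by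
  unfold Ph
  rw [bmp_far hr h, zero_mul]

lemma Ph_high {k : ℤ} {r : ℝ} (hr : 0 < r) {y : W d} (h : r ≤ y.1) :
    Ph k r y = bmp d (r⁻¹ • (y.2 - kap d k)) := by
  unfold Ph
  rw [Real.smoothTransition.one_of_one_le (by rwa [le_div_iff₀ hr, one_mul]), mul_one]

lemma Ph_local {k : ℤ} {r : ℝ} (hr : 0 < r) {y : W d} (h : 2 * r ≤ dist y (0, kap d k)) :
    ∃ ψ : E d → ℝ, ContDiff ℝ 2 ψ ∧ ∀ᶠ y' in 𝓝 y, Ph k r y' = ψ y'.2 := by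
  rw [Prod.dist_eq, le_max_iff, Real.dist_eq, sub_zero, le_abs'] at h
  rcases h with (h | h) | h
  · refine ⟨fun _ => 0, contDiff_const, ?_⟩
    filter_upwards [IsOpen.mem_nhds (isOpen_lt (f := fun y : W d => y.1) (g := fun _ => 0)
      continuous_fst continuous_const) (show y.1 < 0 by linarith)] with y' hy'
    exact Ph_neg hr (le_of_lt hy')
  · refine ⟨fun v => bmp d (r⁻¹ • (v - kap d k)),
      (bmp d).contDiff.comp ((contDiff_id.sub contDiff_const).const_smul _), ?_⟩
    filter_upwards [IsOpen.mem_nhds (isOpen_lt (f := fun _ => r) (g := fun y : W d => y.1)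
      continuous_const continuous_fst) (show r < y.1 by linarith)] with y' hy'
    exact Ph_high hr (le_of_lt hy')
  · refine ⟨fun _ => 0, contDiff_const, ?_⟩
    filter_upwards [IsOpen.mem_nhds (isOpen_lt (f := fun _ => r)
      (g := fun y : W d => ‖y.2 - kap d k‖)
      continuous_const (continuous_snd.sub continuous_const).norm)
      (show r < ‖y.2 - kap d k‖ by rw [← dist_eq_norm]; linarith)] with y' hy'
    have hyl := le_of_lt hy'
    exact Ph_far hr hyl

/-- The integrand. -/
noncomputable def Jf (k : ℤ) (r : ℝ) (f : E d → W d) (x : E d) : ℝ :=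
  Ph k r (f x) * detF d (fun i => fderiv ℝ (fun x => (f x).2) x (Pi.single i 1))

/-- The local degree integral. -/
noncomputable def Kf (k : ℤ) (r : ℝ) (f : E d → W d) : ℝ := ∫ x, Jf k r f x

/-- The pulled back form. -/
noncomputable def Om (k : ℤ) (r : ℝ) (F : E (d+1) → W d) (p : E (d+1)) :
    E (d+1) [⋀^Fin (d+1)]→L[ℝ] ℝ :=
  (Ph k r (F p) • detF d).compContinuousLinearMap (fderiv ℝ (fun q => (F q).2) p)

lemma Om_diff {k : ℤ} {r : ℝ} {F : E (d+1) → W d} (hF : ContDiff ℝ 2 F) :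
    Differentiable ℝ (Om k r F) := by
  have hu : ContDiff ℝ 2 (fun q => (F q).2) := contDiff_snd.comp hF
  have h1 : Differentiable ℝ (fun p => Ph k r (F p)) :=
    ((Ph_contDiff (n := 2) k r).comp hF).differentiable (by norm_num)
  have h2 : Differentiable ℝ (fderiv ℝ (fun q => (F q).2)) :=
    (hu.fderiv_right (m := 1) (by norm_num)).differentiable (by norm_num)
  intro p
  have h3 : DifferentiableAt ℝ (fun p => Ph k r (F p) • detF d) p :=
    (h1 p).smul_const _
  exact (h3.hasFDerivAt.continuousAlternatingMapCompContinuousLinearMap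
    (h2 p).hasFDerivAt).differentiableAt

lemma form_top_zero (η : E d [⋀^Fin (d+2)]→L[ℝ] ℝ) : η = 0 := by
  ext v
  refine η.toAlternatingMap.map_linearDependent v ?_
  intro h
  have := h.fintype_card_le_finrank
  simp at this

lemma Om_closed {k : ℤ} {r : ℝ} (hr : 0 < r) {F : E (d+1) → W d} (hF : ContDiff ℝ 2 F)
    {p : E (d+1)} (h : 2 * r ≤ dist (F p) (0, kap d k)) : extDeriv (Om k r F) p = 0 := by
  have hu : ContDiff ℝ 2 (fun q => (F q).2) := contDiff_snd.comp hF
  obtain ⟨ψ, hψ, he⟩ := Ph_local hr h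
  have he' : Om k r F =ᶠ[𝓝 p] fun q =>
      ((fun v => ψ v • detF d) ((fun q => (F q).2) q)).compContinuousLinearMap
        (fderiv ℝ (fun q => (F q).2) q) := by
    filter_upwards [hF.continuous.continuousAt.eventually he] with q hq
    unfold Om
    rw [hq]
  have hp := extDeriv_pullback (r := 2) (x := p) (ω := fun v => ψ v • detF d)
    (f := fun q => (F q).2) (((hψ.differentiable (by norm_num)).smul_const _) _)
    hu.contDiffAt (by simp)
  rw [he'.extDeriv_eq]
  refine hp.trans ?_
  rw [form_top_zero (extDeriv _ _)]
  ext; simp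

/-- The linear inclusion of a slice. -/
noncomputable def slL (d : ℕ) : E d →L[ℝ] E (d+1) :=
  ContinuousLinearMap.pi (Fin.cases 0 (fun i => ContinuousLinearMap.proj i))

lemma cons_eq (t : ℝ) (x : E d) : (Fin.cons t x : E (d+1)) = (Fin.cons t (0 : E d) : E (d+1)) + slL d x := by
  funext i
  refine Fin.cases ?_ (fun j => ?_) i <;> simp [slL]

lemma slL_single (i : Fin (d+1)) : slL d (Pi.single i 1) = Pi.single i.succ 1 := by
  funext j
  refine Fin.cases ?_ (fun j => ?_) j
  · simp [slL]
  · simp [slL, Pi.single_apply]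

lemma cons_hasFDerivAt (t : ℝ) (x : E d) :
    HasFDerivAt (fun x : E d => (Fin.cons t x : E (d+1))) (slL d) x := by
  have : (fun x : E d => (Fin.cons t x : E (d+1))) =
      fun x => (Fin.cons t (0 : E d) : E (d+1)) + slL d x := funext (cons_eq t)
  rw [this]
  exact (slL d).hasFDerivAt.const_add _

lemma Jf_slice {k : ℤ} {r : ℝ} {F : E (d+1) → W d} (hF : ContDiff ℝ 2 F) (t : ℝ) (x : E d) :
    Jf k r (fun x => F (Fin.cons t x)) x =
      Om k r F (Fin.cons t x) (fun i => Pi.single i.succ 1) := by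
  have hu : ContDiff ℝ 2 (fun q => (F q).2) := contDiff_snd.comp hF
  have h1 : HasFDerivAt (fun x : E d => (F (Fin.cons t x)).2)
      ((fderiv ℝ (fun q => (F q).2) (Fin.cons t x)).comp (slL d)) x := by
    have := (hu.differentiable (by norm_num) (Fin.cons t x)).hasFDerivAt.comp x
      (cons_hasFDerivAt t x)
    exact this
  unfold Jf Om
  rw [h1.fderiv]
  simp [slL_single, Function.comp_def]

lemma Om_base {k : ℤ} {r : ℝ} (hr : 0 < r) (hb : b.1.1 < 0) {F : E (d+1) → W d} {p : E (d+1)}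
    (h : F p = b.1) : Om k r F p = 0 := by
  unfold Om
  rw [h, Ph_neg hr hb.le]
  ext; simp

lemma Jf_base {k : ℤ} {r : ℝ} (hr : 0 < r) (hb : b.1.1 < 0) {f : E d → W d} {x : E d}
    (h : f x = b.1) : Jf k r f x = 0 := by
  unfold Jf
  rw [h, Ph_neg hr hb.le, zero_mul]

lemma K_inv {k : ℤ} {r : ℝ} (hr : 0 < r) (hb : b.1.1 < 0) {F : E (d+1) → W d}
    (hF : ContDiff ℝ 2 F) (hB : ∀ p : E (d+1), Out (Fin.tail p : E d) → F p = b.1)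
    (hd : ∀ p, 2 * r ≤ dist (F p) (0, kap d k)) :
    Kf k r (fun x => F (Fin.cons 0 x)) = Kf k r (fun x => F (Fin.cons 1 x)) := by
  set a : E (d+1) := Fin.cons 0 (fun _ => -1) with ha
  set c : E (d+1) := Fin.cons 1 (fun _ => 2) with hc
  have hac : a ≤ c := by
    intro i
    refine Fin.cases ?_ (fun j => ?_) i <;> simp [ha, hc] <;> norm_num
  have hO := Om_diff (k := k) (r := r) hF
  let e : Fin (d+2) → E (d+1) := fun i => Pi.single i 1
  let f : Fin (d+2) → E (d+1) → ℝ := fun i p => (-1:ℝ)^i.val * Om k r F p (i.removeNth e)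
  have hfd : ∀ i, Differentiable ℝ (f i) := fun i =>
    (hO.continuousAlternatingMap_apply_const _).const_mul _
  have hsum : ∀ p, ∑ i, fderiv ℝ (f i) p (Pi.single i 1) = 0 := by
    intro p
    have h1 := extDeriv_apply (hO p) e
    rw [Om_closed hr hF (hd p)] at h1
    refine Eq.trans ?_ h1.symm
    refine Finset.sum_congr rfl fun i _ => ?_
    have : fderiv ℝ (f i) p = (-1:ℝ)^i.val • fderiv ℝ (fun q => Om k r F q (i.removeNth e)) p :=
      fderiv_const_mul ((hO.continuousAlternatingMap_apply_const _) p) _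
    rw [this]
    simp [e]
  have hdiv := MeasureTheory.integral_divergence_of_hasFDerivAt_off_countable' a c hac f
    (fun i p => fderiv ℝ (f i) p) ∅ countable_empty
    (fun i => (hfd i).continuous.continuousOn)
    (fun p _ i => (hfd i p).hasFDerivAt) (by simp only [hsum]; exact MeasureTheory.integrableOn_zero)
  simp only [hsum, MeasureTheory.integral_zero] at hdiv
  rw [Fin.sum_univ_succ] at hdiv
  have hside : ∀ i : Fin (d+1), ∀ s : ℝ, (s ≤ 0 ∨ 1 ≤ s) → ∀ x : E d,
      f i.succ (Fin.insertNth (α := fun _ => ℝ) i.succ s x) = 0 := by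
    intro i s hs x
    have : Om k r F (Fin.insertNth (α := fun _ => ℝ) i.succ s x) = 0 := by
      refine Om_base hr hb (hB _ ⟨i, ?_⟩)
      simpa [Fin.tail] using hs
    simp only [f, this]
    simp
  have hz : ∀ i : Fin (d+1), ((∫ x in Icc (a ∘ Fin.succAbove i.succ) (c ∘ Fin.succAbove i.succ),
      f i.succ (Fin.insertNth i.succ (c i.succ) x)) -
        ∫ x in Icc (a ∘ Fin.succAbove i.succ) (c ∘ Fin.succAbove i.succ),
          f i.succ (Fin.insertNth i.succ (a i.succ) x)) = 0 := by
    intro i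
    simp only [hside i (c i.succ) (by right; simp [hc]), hside i (a i.succ) (by left; simp [ha])]
    simp
  rw [Finset.sum_eq_zero (fun i _ => hz i), add_zero] at hdiv
  have hface : ∀ t : ℝ, Kf k r (fun x => F (Fin.cons t x)) =
      ∫ x in Icc (a ∘ Fin.succAbove 0) (c ∘ Fin.succAbove 0), f 0 (Fin.insertNth 0 t x) := by
    intro t
    unfold Kf
    rw [← MeasureTheory.setIntegral_eq_integral_of_forall_compl_eq_zero
      (s := Icc (a ∘ Fin.succAbove 0) (c ∘ Fin.succAbove 0))]
    · refine MeasureTheory.setIntegral_congr_fun measurableSet_Icc fun x _ => ?_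
      rw [Jf_slice hF]
      simp only [f, Fin.val_zero, pow_zero, one_mul]
      rw [Fin.insertNth_zero']
      rfl
    · intro x hx
      refine Jf_base hr hb (hB _ ?_)
      rw [Fin.tail_cons]
      by_contra hno
      apply hx
      unfold Out at hno
      push Not at hno
      refine ⟨fun i => ?_, fun i => ?_⟩
      · simp [ha]; linarith [(hno i).1]
      · simp [hc]; linarith [(hno i).2]
  rw [hface, hface]
  have e0 : a 0 = 0 := rfl
  have e1 : c 0 = 1 := rfl
  rw [e0, e1] at hdiv
  linarith
end CP

namespace CP
open scoped Topology Topology.Homotopy unitInterval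
open Set
variable {d : ℕ} {b : Ym d}

lemma isClosed_Out : IsClosed {x : E d | Out x} := by
  have : {x : E d | Out x} = ⋃ i, ({x : E d | x i ≤ 0} ∪ {x | 1 ≤ x i}) := by
    ext x; simp [Out]
  rw [this]
  refine isClosed_iUnion_of_finite fun i => IsClosed.union ?_ ?_
  · exact isClosed_le (continuous_apply i) continuous_const
  · exact isClosed_le continuous_const (continuous_apply i)

/-- The collar of the cube. -/
def Col (d : ℕ) : Set (E d) := {x | ∃ i, x i < 1/4 ∨ 3/4 < x i}

lemma isOpen_Col : IsOpen (Col d) := by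
  have : Col d = ⋃ i, ({x : E d | x i < 1/4} ∪ {x | 3/4 < x i}) := by
    ext x; simp [Col]
  rw [this]
  refine isOpen_iUnion fun i => IsOpen.union ?_ ?_
  · exact isOpen_lt (continuous_apply i) continuous_const
  · exact isOpen_lt continuous_const (continuous_apply i)

lemma Out_Col : {x : E d | Out x} ⊆ Col d := by
  rintro x ⟨i, h | h⟩
  · exact ⟨i, Or.inl (by linarith)⟩
  · exact ⟨i, Or.inr (by linarith)⟩

/-- smooth approximation relative to a closed set -/
lemma smooth_approx (f : RL b) {S U : Set (E d)} (hS : IsClosed S) (hO : {x | Out x} ⊆ S)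
    (hU : U ∈ 𝓝ˢ S) (hf : ContDiffOn ℝ 2 f U) {ε : ℝ} (hε : 0 < ε) :
    ∃ g : RL b, ContDiff ℝ 2 g ∧ lc g = lc f ∧ EqOn g f S ∧ ∀ x, dist (g x) (f x) < ε := by
  obtain ⟨ρ, hρ, hρ'⟩ := f.exists_rho
  obtain ⟨g, hg, hd, he, -⟩ := f.cont.exists_contDiff_approx_and_eqOn 2
    (continuous_const (y := min ε ρ)) (fun _ => lt_min hε hρ) hS hU (by exact_mod_cast hf)
  have hav : ∀ t ∈ Icc (0:ℝ) 1, ∀ x, g x + t • (f x - g x) ∉ Pun d := by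
    intro t ht x hp
    have h1 := hρ' x _ hp
    have h2 : dist (f x) (g x + t • (f x - g x)) = (1 - t) * dist (f x) (g x) := by
      rw [dist_eq_norm, dist_eq_norm,
        show f x - (g x + t • (f x - g x)) = (1 - t) • (f x - g x) by module,
        norm_smul, Real.norm_of_nonneg (by linarith [ht.2])]
    have h3 := lt_of_lt_of_le (hd x) (min_le_right _ _)
    rw [dist_comm] at h3
    have h4 : (1 - t) * dist (f x) (g x) ≤ 1 * dist (f x) (g x) :=
      mul_le_mul_of_nonneg_right (by linarith [ht.1]) dist_nonneg
    linarith
  have hbd : ∀ x, Out x → g x = b.1 := fun x hx => (he (hO hx)).trans (f.bd x hx)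
  let G : RL b := ⟨g, hg.continuous, fun x => by simpa using hav 0 (by simp) x, hbd⟩
  refine ⟨G, by exact_mod_cast hg, ?_, he, fun x => (hd x).trans_le (min_le_left _ _)⟩
  refine lc_eq_of (fun t x => g x + t • (f x - g x)) ?_ (fun x => by simp [G]) (fun x => by simp)
    hav ?_
  · have := hg.continuous
    have := f.cont
    fun_prop
  · intro t _ x hx
    simp [hbd x hx, f.bd x hx]

/-- scaling about the centre -/
noncomputable def scT (t : ℝ) (x : E d) : E d := fun i => (1 + t^2) * x i - t^2/2

lemma scT_zero (x : E d) : scT 0 x = x := by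
  funext i; simp [scT]

lemma scT_contDiff : ContDiff ℝ 2 (fun z : ℝ × E d => scT z.1 z.2) := by
  unfold scT
  refine contDiff_pi.2 fun i => ?_
  have h : ContDiff ℝ 2 (fun z : ℝ × E d => z.2 i) := (contDiff_apply ℝ ℝ i).comp contDiff_snd
  have h2 : ContDiff ℝ 2 (fun z : ℝ × E d => z.1) := contDiff_fst
  fun_prop

lemma scT_out {t : ℝ} {x : E d} (h : Out x) : Out (scT t x) := by
  obtain ⟨i, hi⟩ := h
  refine ⟨i, ?_⟩
  unfold scT
  rcases hi with hi | hi
  · left; nlinarith [sq_nonneg t]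
  · right; nlinarith [sq_nonneg t]

lemma scT_col {x : E d} (h : x ∈ Col d) : Out (scT 1 x) := by
  obtain ⟨i, hi⟩ := h
  refine ⟨i, ?_⟩
  unfold scT
  rcases hi with hi | hi
  · left; linarith
  · right; linarith

/-- the scaled loop -/
noncomputable def RL.sc (f : RL b) : RL b :=
  ⟨fun x => f (scT 1 x),
    f.cont.comp (scT_contDiff.continuous.comp (continuous_const.prodMk continuous_id)),
    fun _ => f.avoid _, fun _ hx => f.bd _ (scT_out hx)⟩

lemma lc_sc (f : RL b) : lc f.sc = lc f := by
  symm
  refine lc_eq_of (fun t x => f (scT t x)) (f.cont.comp scT_contDiff.continuous)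
    (fun x => by rw [scT_zero]) (fun x => rfl) (fun _ _ _ => f.avoid _)
    (fun _ _ x hx => f.bd _ (scT_out hx))

lemma RL.sc_col (f : RL b) {x : E d} (h : x ∈ Col d) : f.sc x = b.1 := f.bd _ (scT_col h)

lemma RL.sc_smooth {f : RL b} (h : ContDiff ℝ 2 f) : ContDiff ℝ 2 f.sc :=
  h.comp (scT_contDiff.comp (contDiff_const.prodMk contDiff_id))

lemma exists_smooth (a : HomotopyGroup (Fin (d+1)) (Ym d) b) :
    ∃ g : RL b, ContDiff ℝ 2 g ∧ lc g = a := by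
  obtain ⟨f, rfl⟩ := lc_surj a
  obtain ⟨g, hg, hl, -⟩ := smooth_approx f.sc isClosed_Out (Subset.refl _)
    (isOpen_Col.mem_nhdsSet.2 Out_Col)
    ((contDiffOn_const (c := b.1)).congr fun x hx => f.sc_col hx) one_pos
  exact ⟨g, hg, hl.trans (lc_sc f)⟩

lemma K_inv_ev {k : ℤ} (hb : b.1.1 < 0) {F : E (d+1) → W d}
    (hF : ContDiff ℝ 2 F) (hB : ∀ p : E (d+1), Out (Fin.tail p : E d) → F p = b.1)
    {ρ : ℝ} (hρ : 0 < ρ) (hd : ∀ p, ∀ q ∈ Pun d, ρ ≤ dist (F p) q) {f g : E d → W d}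
    (h0 : ∀ x, F (Fin.cons 0 x) = f x) (h1 : ∀ x, F (Fin.cons 1 x) = g x) :
    ∀ᶠ r in 𝓝[>] (0:ℝ), Kf k r f = Kf k r g := by
  have h2 : ∀ᶠ r in 𝓝[>] (0:ℝ), r < ρ/2 :=
    eventually_nhdsWithin_of_eventually_nhds (Iio_mem_nhds (by positivity))
  filter_upwards [h2, self_mem_nhdsWithin] with r hr hr0
  have := K_inv (k := k) (r := r) hr0 hb hF hB (fun p => by
    have := hd p (0, kap d k) ⟨rfl, k, rfl⟩
    linarith)
  simpa only [h0, h1] using this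

lemma tail_contDiff : ContDiff ℝ 2 (fun p : E (d+1) => (Fin.tail p : E d)) :=
  contDiff_pi.2 fun _ => contDiff_apply ℝ ℝ _

lemma K_sc {k : ℤ} (hb : b.1.1 < 0) {f : RL b} (hf : ContDiff ℝ 2 f) :
    ∀ᶠ r in 𝓝[>] (0:ℝ), Kf k r f = Kf k r f.sc := by
  obtain ⟨ρ, hρ, hρ'⟩ := f.exists_rho
  refine K_inv_ev hb (F := fun p => f (scT (p 0) (Fin.tail p : E d))) ?_ ?_ hρ
    (fun p q hq => hρ' _ q hq) ?_ ?_
  · exact hf.comp (scT_contDiff.comp ((contDiff_apply ℝ ℝ _).prodMk tail_contDiff))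
  · intro p hp
    exact f.bd _ (scT_out hp)
  · intro x; simp [scT_zero]
  · intro x; simp [RL.sc]

lemma K_eq {k : ℤ} (hb : b.1.1 < 0) {f g : RL b} (hf : ContDiff ℝ 2 f) (hg : ContDiff ℝ 2 g)
    (h : lc f = lc g) : ∀ᶠ r in 𝓝[>] (0:ℝ), Kf k r f = Kf k r g := by
  obtain ⟨H, Hc, H0, H1, Ha, Hb⟩ := exists_of_lc_eq h
  have hrange : ∀ t x, H t x ∈ (fun z : I × (Fin (d+1) → I) => H z.1 (fun i => (z.2 i : ℝ))) '' univ := by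
    intro t x
    have hx : ∃ z : Fin (d+1) → I, H t x = H t (fun i => (z i : ℝ)) := by
      let ft : RL b := ⟨H t, Hc.comp (continuous_const.prodMk continuous_id), Ha t, Hb t⟩
      exact ⟨clE x, (ft.coe_clE x).symm⟩
    obtain ⟨z, hz⟩ := hx
    rw [hz]
    rcases le_total t 0 with ht | ht
    · exact ⟨(0, z), trivial, by simp [H0 t ht, H0 0 le_rfl]⟩
    · rcases le_total 1 t with ht' | ht'
      · exact ⟨(1, z), trivial, by simp [H1 t ht', H1 1 le_rfl]⟩
      · exact ⟨(⟨t, ht, ht'⟩, z), trivial, rfl⟩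
  obtain ⟨ρ, hρ, hρ'⟩ := exists_rho_compact (d := d)
    (isCompact_univ.image (f := fun z : I × (Fin (d+1) → I) => H z.1 (fun i => (z.2 i : ℝ)))
      (Hc.comp (f := fun z : I × (Fin (d + 1) → I) => ((z.1 : ℝ), fun i => (z.2 i : ℝ)))
      (by fun_prop))) (by rintro _ ⟨z, -, rfl⟩; exact Ha _ _)
  let F0 : E (d+1) → W d := fun p => H (3 * p 0 - 1) (scT 1 (Fin.tail p : E d))
  have hF0 : Continuous F0 := by
    refine Hc.comp (Continuous.prodMk (by fun_prop) ?_)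
    exact scT_contDiff.continuous.comp (continuous_const.prodMk tail_contDiff.continuous)
  have hsct : ContDiff ℝ 2 (fun p : E (d+1) => scT 1 (Fin.tail p : E d)) :=
    scT_contDiff.comp (contDiff_const.prodMk tail_contDiff)
  let S : Set (E (d+1)) := ({p | p 0 ≤ 0} ∪ {p | 1 ≤ p 0}) ∪ (fun p => (Fin.tail p : E d)) ⁻¹' {x | Out x}
  let U : Set (E (d+1)) := ({p | p 0 < 1/3} ∪ {p | 2/3 < p 0}) ∪ (fun p => (Fin.tail p : E d)) ⁻¹' Col d
  have hS : IsClosed S := by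
    refine ((isClosed_le (continuous_apply 0) continuous_const).union
      (isClosed_le continuous_const (continuous_apply 0))).union
      (isClosed_Out.preimage tail_contDiff.continuous)
  have o1 : IsOpen {p : E (d+1) | p 0 < 1/3} := isOpen_lt (continuous_apply 0) continuous_const
  have o2 : IsOpen {p : E (d+1) | 2/3 < p 0} := isOpen_lt continuous_const (continuous_apply 0)
  have o3 : IsOpen ((fun p : E (d+1) => (Fin.tail p : E d)) ⁻¹' Col d) :=
    isOpen_Col.preimage tail_contDiff.continuous
  have hU : IsOpen U := (o1.union o2).union o3
  have hSU : S ⊆ U := by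
    rintro p ((hp | hp) | hp)
    · left; left; change p 0 < 1/3; change p 0 ≤ 0 at hp; linarith
    · left; right; change 2/3 < p 0; change 1 ≤ p 0 at hp; linarith
    · right; exact Out_Col hp
  have hFU : ContDiffOn ℝ 2 F0 U := by
    rintro p ((hp | hp) | hp)
    · refine (ContDiffAt.congr_of_eventuallyEq (hf.comp hsct).contDiffAt ?_).contDiffWithinAt
      filter_upwards [o1.mem_nhds hp] with q hq
      change q 0 < 1/3 at hq
      exact H0 _ (by linarith) _
    · refine (ContDiffAt.congr_of_eventuallyEq (hg.comp hsct).contDiffAt ?_).contDiffWithinAt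
      filter_upwards [o2.mem_nhds hp] with q hq
      change 2/3 < q 0 at hq
      exact H1 _ (by linarith) _
    · refine (ContDiffAt.congr_of_eventuallyEq (contDiffAt_const (c := b.1)) ?_).contDiffWithinAt
      filter_upwards [o3.mem_nhds hp] with q hq
      exact Hb _ _ (scT_col hq)
  obtain ⟨G, hG, hd, he, -⟩ := hF0.exists_contDiff_approx_and_eqOn 2
    (continuous_const (y := ρ/2)) (fun _ => by positivity) hS (hU.mem_nhdsSet.2 hSU)
    (by exact_mod_cast hFU)
  have key : ∀ᶠ r in 𝓝[>] (0:ℝ), Kf k r f.sc = Kf k r g.sc := by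
    refine K_inv_ev hb (F := G) (by exact_mod_cast hG) ?_ (half_pos hρ) ?_ ?_ ?_
    · intro p hp
      rw [he (Or.inr hp)]
      exact Hb _ _ (scT_out hp)
    · intro p q hq
      have h1 := hρ' _ (hrange (3 * p 0 - 1) (scT 1 (Fin.tail p : E d))) q hq
      have h2 := hd p
      have h3 := dist_triangle_left (F0 p) q (G p)
      change ρ ≤ dist (F0 p) q at h1
      linarith
    · intro x
      rw [he (Or.inl (Or.inl (by simp)))]
      simp only [F0, Fin.cons_zero, Fin.tail_cons]
      exact H0 _ (by norm_num) _
    · intro x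
      rw [he (Or.inl (Or.inr (by simp)))]
      simp only [F0, Fin.cons_zero, Fin.tail_cons]
      exact H1 _ (by norm_num) _
  filter_upwards [K_sc (k := k) hb hf, K_sc (k := k) hb hg, key] with r h1 h2 h3
  rw [h1, h2, h3]
end CP

namespace CP
open scoped Topology Topology.Homotopy unitInterval
open Set
variable {d : ℕ} {b : Ym d}

lemma Jf_cont {k : ℤ} {r : ℝ} {f : E d → W d} (hf : ContDiff ℝ 2 f) : Continuous (Jf k r f) := by
  have hu : ContDiff ℝ 2 (fun q => (f q).2) := contDiff_snd.comp hf
  have h2 : Continuous (fderiv ℝ (fun q => (f q).2)) := hu.continuous_fderiv (by norm_num)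
  unfold Jf
  refine Continuous.mul ?_ ?_
  · exact (Ph_contDiff (n := 2) k r).continuous.comp hf.continuous
  · refine (detF d).cont.comp (continuous_pi fun i => ?_)
    exact h2.clm_apply continuous_const

lemma Jf_integrable {k : ℤ} {r : ℝ} (hr : 0 < r) (hb : b.1.1 < 0) {f : RL b}
    (hf : ContDiff ℝ 2 f) : MeasureTheory.Integrable (Jf k r f) := by
  refine (Jf_cont hf).integrable_of_hasCompactSupport ?_
  refine HasCompactSupport.intro (K := Icc (0 : E d) 1) isCompact_Icc fun x hx => ?_
  refine Jf_base hr hb (f.bd _ ?_)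
  by_contra hno
  apply hx
  unfold Out at hno
  push Not at hno
  exact ⟨fun i => (hno i).1.le, fun i => (hno i).2.le⟩

/-- doubling of one coordinate -/
noncomputable def dbl (i : Fin (d+1)) (c : ℝ) (x : E d) : E d := Function.update x i (2 * x i - c)

/-- its derivative -/
noncomputable def Ldbl (i : Fin (d+1)) : E d →L[ℝ] E d :=
  mclm (Matrix.diagonal (Function.update (fun _ => (1:ℝ)) i 2))

lemma dbl_eq (i : Fin (d+1)) (c : ℝ) (x : E d) : dbl i c x = Ldbl i x - Pi.single i c := by
  funext j
  simp only [dbl, Ldbl, mclm_apply, Matrix.mulVec_diagonal, Pi.sub_apply]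
  by_cases h : j = i
  · subst h; simp
  · simp [h]

lemma dbl_hasFDerivAt (i : Fin (d+1)) (c : ℝ) (x : E d) : HasFDerivAt (dbl i c) (Ldbl i) x := by
  rw [show (dbl i c : E d → E d) = fun x => Ldbl i x - Pi.single i c from funext (dbl_eq i c)]
  exact (Ldbl i).hasFDerivAt.sub_const _

lemma dbl_contDiff (i : Fin (d+1)) (c : ℝ) : ContDiff ℝ 2 (dbl i c : E d → E d) := by
  rw [show (dbl i c : E d → E d) = fun x => Ldbl i x - Pi.single i c from funext (dbl_eq i c)]
  exact (Ldbl i).contDiff.sub contDiff_const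

lemma Ldbl_det (i : Fin (d+1)) : (Ldbl (d := d) i).det = 2 := by
  unfold Ldbl mclm
  rw [ContinuousLinearMap.det, LinearMap.coe_toContinuousLinearMap, LinearMap.det_toLin',
    Matrix.det_diagonal, Finset.prod_update_of_mem (Finset.mem_univ i)]
  simp

lemma Ldbl_single (i j : Fin (d+1)) : Ldbl (d := d) i (Pi.single j 1) =
    (Function.update (fun _ => (1:ℝ)) i 2 j) • Pi.single j 1 := by
  funext l
  simp only [Ldbl, mclm_apply, Matrix.mulVec_diagonal, Pi.smul_apply, smul_eq_mul]
  by_cases h : l = j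
  · subst h; rfl
  · simp [h]

lemma dbl_inj (i : Fin (d+1)) (c : ℝ) : Function.Injective (dbl i c : E d → E d) := by
  intro x y h
  funext j
  have := congrFun h j
  by_cases hj : j = i
  · subst hj; simp [dbl] at this; exact this
  · simpa [dbl, hj] using this

lemma dbl_surj (i : Fin (d+1)) (c : ℝ) : Function.Surjective (dbl i c : E d → E d) := by
  intro y
  refine ⟨Function.update y i ((y i + c)/2), ?_⟩
  funext j
  by_cases hj : j = i
  · subst hj; simp [dbl]; ring
  · simp [dbl, hj]

lemma integral_dbl (i : Fin (d+1)) (c : ℝ) (g : E d → ℝ) :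
    ∫ x, 2 * g (dbl i c x) = ∫ x, g x := by
  have := MeasureTheory.integral_image_eq_integral_abs_det_fderiv_smul
    (MeasureTheory.volume : MeasureTheory.Measure (E d)) MeasurableSet.univ
    (f := dbl i c) (f' := fun _ => Ldbl i) (fun x _ => (dbl_hasFDerivAt i c x).hasFDerivWithinAt)
    (dbl_inj i c).injOn g
  rw [image_univ, (dbl_surj i c).range_eq] at this
  simp only [MeasureTheory.Measure.restrict_univ, Ldbl_det, abs_two, smul_eq_mul] at this
  exact this.symm

lemma Jf_dbl {k : ℤ} {r : ℝ} {f h : E d → W d} (hf : ContDiff ℝ 2 f) (i : Fin (d+1)) (c : ℝ)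
    {x : E d} (he : h =ᶠ[𝓝 x] fun y => f (dbl i c y)) : Jf k r h x = 2 * Jf k r f (dbl i c x) := by
  have hu : ContDiff ℝ 2 (fun q => (f q).2) := contDiff_snd.comp hf
  have h1 : HasFDerivAt (fun y => (f (dbl i c y)).2)
      ((fderiv ℝ (fun q => (f q).2) (dbl i c x)).comp (Ldbl i)) x :=
    HasFDerivAt.comp x (f := dbl i c) (g := fun q => (f q).2)
      (hu.differentiable (by norm_num) (dbl i c x)).hasFDerivAt (dbl_hasFDerivAt i c x)
  have h2 : (fun y => (h y).2) =ᶠ[𝓝 x] fun y => (f (dbl i c y)).2 := by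
    filter_upwards [he] with y hy
    rw [hy]
  unfold Jf
  rw [h2.fderiv_eq, h1.fderiv, he.self_of_nhds]
  simp only [ContinuousLinearMap.comp_apply, Ldbl_single, map_smul]
  rw [show (detF d) (fun j => Function.update (fun _ => (1:ℝ)) i 2 j •
      (fderiv ℝ (fun q => (f q).2) (dbl i c x)) (Pi.single j 1)) = 2 * detF d (fun j =>
      (fderiv ℝ (fun q => (f q).2) (dbl i c x)) (Pi.single j 1)) from ?_]
  · ring
  · have := (detF d).toMultilinearMap.map_smul_univ (Function.update (fun _ => (1:ℝ)) i 2)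
      (fun j => (fderiv ℝ (fun q => (f q).2) (dbl i c x)) (Pi.single j 1))
    rw [Finset.prod_update_of_mem (Finset.mem_univ i)] at this
    simpa using this

lemma RL.trans_smooth {f g : RL b} (hf : ContDiff ℝ 2 f) (hg : ContDiff ℝ 2 g) (i : Fin (d+1)) :
    ContDiff ℝ 2 (RL.trans i f g) := by
  have h : (RL.trans i f g : E d → W d) = fun x => f (dbl i 0 x) + g (dbl i 1 x) - b.1 := by
    funext x; simp [RL.trans, dbl]
  rw [h]
  exact ((hf.comp (dbl_contDiff i 0)).add (hg.comp (dbl_contDiff i 1))).sub contDiff_const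

lemma Jf_trans {k : ℤ} {r : ℝ} (hr : 0 < r) (hb : b.1.1 < 0) {f g : RL b} (hf : ContDiff ℝ 2 f)
    (hg : ContDiff ℝ 2 g) (i : Fin (d+1)) (x : E d) :
    Jf k r (RL.trans i f g) x = 2 * Jf k r f (dbl i 0 x) + 2 * Jf k r g (dbl i 1 x) := by
  have fb : 1/2 ≤ x i → f (dbl i 0 x) = b.1 := fun h =>
    f.bd _ ⟨i, Or.inr (by simp [dbl]; linarith)⟩
  have gb : x i ≤ 1/2 → g (dbl i 1 x) = b.1 := fun h =>
    g.bd _ ⟨i, Or.inl (by simp [dbl]; linarith)⟩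
  rcases lt_trichotomy (x i) (1/2) with h | h | h
  · rw [Jf_base hr hb (gb h.le), mul_zero, add_zero]
    refine Jf_dbl hf i 0 ?_
    filter_upwards [IsOpen.mem_nhds (isOpen_lt (f := fun y : E d => y i) (g := fun _ => 1/2)
      (continuous_apply i) continuous_const) h] with y hy
    rw [RL.trans_left i f g y (le_of_lt hy)]
    simp [dbl]
  · rw [Jf_base hr hb (gb h.le), Jf_base hr hb (fb h.ge), mul_zero, add_zero]
    refine Jf_base hr hb ?_
    rw [RL.trans_left i f g x h.le, ← fb h.ge]
    simp [dbl]
  · rw [Jf_base hr hb (fb h.le), mul_zero, zero_add]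
    refine Jf_dbl hg i 1 ?_
    filter_upwards [IsOpen.mem_nhds (isOpen_lt (f := fun _ => 1/2) (g := fun y : E d => y i)
      continuous_const (continuous_apply i)) h] with y hy
    exact RL.trans_right i f g y (le_of_lt hy)

lemma Kf_trans {k : ℤ} {r : ℝ} (hr : 0 < r) (hb : b.1.1 < 0) {f g : RL b} (hf : ContDiff ℝ 2 f)
    (hg : ContDiff ℝ 2 g) (i : Fin (d+1)) :
    Kf k r (RL.trans i f g) = Kf k r f + Kf k r g := by
  unfold Kf
  simp only [Jf_trans hr hb hf hg i]
  have hi : ∀ (f : RL b) (_ : ContDiff ℝ 2 f) (c : ℝ), MeasureTheory.Integrable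
      (fun x => 2 * Jf k r f (dbl i c x)) := by
    intro f hf c
    have := (MeasureTheory.integrableOn_image_iff_integrableOn_abs_det_fderiv_smul
      (MeasureTheory.volume : MeasureTheory.Measure (E d)) MeasurableSet.univ
      (f := dbl i c) (f' := fun _ => Ldbl i) (fun x _ => (dbl_hasFDerivAt i c x).hasFDerivWithinAt)
      (dbl_inj i c).injOn (Jf k r f)).1 (Jf_integrable hr hb hf).integrableOn
    simpa only [MeasureTheory.integrableOn_univ, Ldbl_det, abs_two, smul_eq_mul] using this
  rw [MeasureTheory.integral_add (hi f hf 0) (hi g hg 1), integral_dbl, integral_dbl]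

/-- a smooth representative -/
noncomputable def rep (a : HomotopyGroup (Fin (d+1)) (Ym d) b) : RL b := (exists_smooth a).choose

lemma rep_smooth (a : HomotopyGroup (Fin (d+1)) (Ym d) b) : ContDiff ℝ 2 (rep a) :=
  (exists_smooth a).choose_spec.1

lemma lc_rep (a : HomotopyGroup (Fin (d+1)) (Ym d) b) : lc (rep a) = a :=
  (exists_smooth a).choose_spec.2

/-- The degree homomorphism. -/
noncomputable def Dh (hb : b.1.1 < 0) (k : ℤ) : HomotopyGroup (Fin (d+1)) (Ym d) b →*
    Multiplicative (Filter.Germ (𝓝[>] (0:ℝ)) ℝ) :=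
  MonoidHom.mk' (fun a => Multiplicative.ofAdd
    (Filter.Germ.ofFun (fun r => Kf k r (rep a)) : Filter.Germ (𝓝[>] (0:ℝ)) ℝ)) (by
    intro a c
    rw [← ofAdd_add, ← Filter.Germ.coe_add]
    congr 1
    refine Filter.Germ.coe_eq.2 ?_
    have h1 : lc (RL.trans 0 (rep c) (rep a)) = lc (rep (a * c)) := by
      rw [lc_trans, lc_rep, lc_rep, lc_rep]
    filter_upwards [K_eq (k := k) hb (RL.trans_smooth (rep_smooth c) (rep_smooth a) 0)
      (rep_smooth _) h1, self_mem_nhdsWithin] with r hr hr0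
    rw [← hr, Kf_trans hr0 hb (rep_smooth _) (rep_smooth _), add_comm]
    rfl)

lemma Dh_lc (hb : b.1.1 < 0) (k : ℤ) {g : RL b} (hg : ContDiff ℝ 2 g) :
    Dh hb k (lc g) = Multiplicative.ofAdd
      (Filter.Germ.ofFun (fun r => Kf k r g) : Filter.Germ (𝓝[>] (0:ℝ)) ℝ) := by
  change Multiplicative.ofAdd _ = _
  congr 1
  exact Filter.Germ.coe_eq.2 (K_eq hb (rep_smooth _) hg (lc_rep _))
end CP

namespace CP
open scoped Topology Topology.Homotopy unitInterval
open Set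
variable {d : ℕ} {b : Ym d}

lemma gen_rep (hb : b.1.1 < 0) (j : ℤ) : ∃ (g : RL b) (η : ℝ), ContDiff ℝ 2 g ∧ lc g = gen hb j ∧
    0 < η ∧ η ≤ 1/4 ∧ (∀ x, ‖x - cen d‖ ≤ η → g x = (1, kap d j + (x - cen d))) ∧
    (∀ x, η ≤ ‖x - cen d‖ → ∀ k r, 0 < r → r ≤ η / 2 → Ph k r (g x) = 0) := by
  set A := ContinuousLinearMap.id ℝ (E d)
  set δ := dl A with hδ
  have hδ0 : 0 < δ := dl_pos A
  have hδ4 : δ ≤ 1/4 := min_le_left _ _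
  set f : RL b := LM hb j A (cen d) δ (valid_dl (fun _ h => h) hδ0 le_rfl) with hf
  have hfx : ∀ x, f x = hc b (cut δ (x - cen d)) (1, kap d j + (x - cen d)) := fun x => rfl
  have hnear : ∀ x, ‖x - cen d‖ ≤ δ/2 → f x = (1, kap d j + (x - cen d)) := by
    intro x hx
    rw [hfx, cut_near hδ0 hx, hc_zero]
  have hcolb : ∀ x ∈ Col d, f x = b.1 := by
    rintro x ⟨i, hi⟩
    have h1 : δ ≤ ‖x - cen d‖ := by
      have h2 := norm_le_pi_norm (x - cen d) i
      simp only [Pi.sub_apply, cen, Real.norm_eq_abs] at h2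
      refine le_trans ?_ h2
      rw [le_abs']
      rcases hi with hi | hi
      · left; linarith
      · right; linarith
    rw [hfx, cut_far hδ0 h1, hc_one]
  set ε := min (δ/8) (-b.1.1/2)
  have hε : 0 < ε := lt_min (by positivity) (by linarith)
  have hε1 : ε ≤ δ/8 := min_le_left _ _
  have hε2 : ε ≤ -b.1.1/2 := min_le_right _ _
  obtain ⟨g, hg, hl, he, hd⟩ := smooth_approx f (S := {x | Out x} ∪ Metric.closedBall (cen d) (δ/4))
    (U := Col d ∪ Metric.ball (cen d) (δ/2)) (isClosed_Out.union Metric.isClosed_closedBall)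
    subset_union_left ((isOpen_Col.union Metric.isOpen_ball).mem_nhdsSet.2
      (union_subset_union Out_Col (Metric.closedBall_subset_ball (by linarith)))) (by
      rintro x (hx | hx)
      · refine (ContDiffAt.congr_of_eventuallyEq (contDiffAt_const (c := b.1)) ?_).contDiffWithinAt
        filter_upwards [isOpen_Col.mem_nhds hx] with q hq using hcolb q hq
      · refine (ContDiffAt.congr_of_eventuallyEq (f := fun x => ((1:ℝ), kap d j + (x - cen d)))
          ?_ ?_).contDiffWithinAt
        · exact (contDiff_const.prodMk (contDiff_const.add (contDiff_id.sub contDiff_const))).contDiffAt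
        · filter_upwards [Metric.isOpen_ball.mem_nhds hx] with q hq
          refine hnear q ?_
          rw [← dist_eq_norm]; exact (Metric.mem_ball.1 hq).le) hε
  refine ⟨g, δ/4, hg, hl, by positivity, by linarith, ?_, ?_⟩
  · intro x hx
    rw [he (Or.inr (by rw [Metric.mem_closedBall, dist_eq_norm]; exact hx)), hnear x (by linarith)]
  · intro x hx k r hr hr2
    have hdx := hd x
    rcases le_total (1/2) (cut δ (x - cen d)) with ht | ht
    · have h1 : (f x).1 ≤ b.1.1 := hc_half' _ _ ht (cut_le_one _ _)
      have h2 : dist (g x).1 (f x).1 ≤ dist (g x) (f x) := le_max_left _ _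
      rw [Real.dist_eq] at h2
      have := (abs_le.1 h2).2
      exact Ph_neg hr (by linarith)
    · have h1 : (f x).2 = kap d j + (x - cen d) := by rw [hfx, hc_half _ _ ht]
      have h2 : dist (g x).2 (f x).2 ≤ dist (g x) (f x) := le_max_right _ _
      have h3 : ‖x - cen d‖ ≤ δ := by
        by_contra h
        push Not at h
        rw [cut_far hδ0 h.le] at ht
        norm_num at ht
      have h4 : δ/4 ≤ ‖(f x).2 - kap d k‖ := by
        rw [h1]
        by_cases hjk : j = k
        · subst hjk
          rwa [add_sub_cancel_left]
        · have h5 := kap_sub_norm (d := d) hjk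
          have h6 : kap d j + (x - cen d) - kap d k = (kap d j - kap d k) + (x - cen d) := by abel
          rw [h6]
          have h7 := norm_sub_le_norm_add (kap d j - kap d k) (x - cen d)
          linarith
      refine Ph_far hr ?_
      have h8 : ‖(f x).2 - kap d k‖ ≤ ‖(g x).2 - kap d k‖ + dist (g x).2 (f x).2 := by
        rw [dist_comm, dist_eq_norm]
        have := norm_add_le ((g x).2 - kap d k) ((f x).2 - (g x).2)
        rwa [show (g x).2 - kap d k + ((f x).2 - (g x).2) = (f x).2 - kap d k by abel] at this
      linarith

lemma Jf_gen {g : E d → W d} {η : ℝ} {j : ℤ}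
    (hg : ∀ x, ‖x - cen d‖ ≤ η → g x = (1, kap d j + (x - cen d))) {x : E d}
    (hx : ‖x - cen d‖ < η) {k : ℤ} {r : ℝ} (hr : 0 < r) (hr1 : r ≤ 1) :
    Jf k r g x = bmp d (r⁻¹ • (kap d j - kap d k + (x - cen d))) := by
  have h2 : (fun y => (g y).2) =ᶠ[𝓝 x] fun y => kap d j + (y - cen d) := by
    filter_upwards [IsOpen.mem_nhds (isOpen_lt (f := fun y : E d => ‖y - cen d‖) (g := fun _ => η)
      (continuous_id.sub continuous_const).norm continuous_const) hx] with y hy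
    rw [hg y (le_of_lt hy)]
  have h3 : HasFDerivAt (fun y => kap d j + (y - cen d)) (ContinuousLinearMap.id ℝ (E d)) x :=
    ((hasFDerivAt_id x).sub_const _).const_add _
  unfold Jf
  rw [h2.fderiv_eq, h3.fderiv, hg x hx.le, Ph_high hr hr1]
  have h4 : detF d (fun i => (ContinuousLinearMap.id ℝ (E d)) (Pi.single i 1)) = 1 := by
    rw [detF_apply]
    convert Matrix.det_one (n := Fin (d+1)) (R := ℝ)
    ext i l
    simp [Matrix.one_apply, Pi.single_apply, eq_comm]
  rw [h4, mul_one]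
  congr 2
  dsimp only
  abel

lemma Dh_gen_ne (hb : b.1.1 < 0) {j k : ℤ} (h : j ≠ k) : Dh hb k (gen hb j) = 1 := by
  obtain ⟨g, η, hg, hl, h0, h4, hin, hout⟩ := gen_rep hb j
  rw [← hl, Dh_lc hb k hg, ← ofAdd_zero]
  congr 1
  refine Filter.Germ.coe_eq.2 ?_
  filter_upwards [self_mem_nhdsWithin, eventually_nhdsWithin_of_eventually_nhds
    (Iio_mem_nhds (half_pos h0))] with r hr hr2
  change r < η/2 at hr2
  change 0 < r at hr
  have : ∀ x, Jf k r g x = 0 := by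
    intro x
    rcases lt_or_ge ‖x - cen d‖ η with hx | hx
    · rw [Jf_gen hin hx hr (by linarith)]
      refine bmp_far hr ?_
      have := norm_sub_le_norm_add (kap d j - kap d k) (x - cen d)
      have := kap_sub_norm (d := d) h
      linarith
    · unfold Jf
      rw [hout x hx k r hr hr2.le, zero_mul]
  simp [Kf, this]

lemma Dh_gen_eq (hb : b.1.1 < 0) (k : ℤ) : Dh hb k (gen hb k) ≠ 1 := by
  obtain ⟨g, η, hg, hl, h0, h4, hin, hout⟩ := gen_rep hb k
  rw [← hl, Dh_lc hb k hg, ← ofAdd_zero]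
  intro he
  have he2 := Filter.Germ.coe_eq.1 (Multiplicative.ofAdd.injective he)
  obtain ⟨r, ⟨hr0, hr, hr2⟩⟩ := (he2.and (Filter.Eventually.and self_mem_nhdsWithin
    (eventually_nhdsWithin_of_eventually_nhds (Iio_mem_nhds (half_pos h0))))).exists
  change r < η/2 at hr2
  change 0 < r at hr
  have : ∀ x, Jf k r g x = bmp d (r⁻¹ • (x - cen d)) := by
    intro x
    rcases lt_or_ge ‖x - cen d‖ η with hx | hx
    · rw [Jf_gen hin hx hr (by linarith), sub_self, zero_add]
    · unfold Jf
      rw [hout x hx k r hr hr2.le, zero_mul, bmp_far hr (by linarith)]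
  have h5 : Kf k r g = r ^ (d+1) * ∫ x, bmp d x := by
    unfold Kf
    simp only [this]
    rw [MeasureTheory.integral_sub_right_eq_self (fun x => bmp d (r⁻¹ • x)) (cen d),
      MeasureTheory.Measure.integral_comp_inv_smul]
    simp [abs_of_pos hr]
  have h6 : 0 < Kf k r g := by
    rw [h5]
    exact mul_pos (pow_pos hr _) (bmp d).integral_pos
  exact h6.ne' hr0

lemma germ_tf (z : ℤ) (a : Filter.Germ (𝓝[>] (0:ℝ)) ℝ) (h : z • a = 0) : z = 0 ∨ a = 0 := by
  by_cases hz : z = 0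
  · exact Or.inl hz
  · right
    induction a using Filter.Germ.inductionOn with
    | h f =>
      rw [← Filter.Germ.coe_smul] at h
      have h2 := Filter.Germ.coe_eq.1 h
      refine Filter.Germ.coe_eq.2 ?_
      filter_upwards [h2] with r hr
      simpa [hz] using hr

theorem model_free (hd : 1 ≤ d) (hb : b.1.1 < 0) :
    Nonempty (HomotopyGroup (Fin (d+1)) (Ym d) b ≃* Multiplicative (ℕ →₀ ℤ)) := by
  haveI : Nontrivial (Fin (d+1)) := Fin.nontrivial_iff_two_le.2 (by omega)
  exact free_of_gens hg_comm (gen hb) (closure_gen hb) germ_tf (fun k => Dh hb k)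
    (fun j k h => Dh_gen_ne hb h) (Dh_gen_eq hb)
end CP

namespace CP
open scoped Topology Topology.Homotopy unitInterval
open Set
variable {d : ℕ}

/-- reflection of the first coordinate -/
def flipW (d : ℕ) : W d ≃ₜ W d := (Homeomorph.neg ℝ).prodCongr (Homeomorph.refl (E d))

/-- shear of the first coordinate -/
noncomputable def shearW (η : E d → ℝ) (hη : Continuous η) : W d ≃ₜ W d where
  toFun y := (y.1 - η y.2, y.2)
  invFun y := (y.1 + η y.2, y.2)
  left_inv y := by simp
  right_inv y := by simp
  continuous_toFun := by fun_prop
  continuous_invFun := by fun_prop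

theorem ym_free (hd : 1 ≤ d) (b : Ym d) :
    Nonempty (HomotopyGroup (Fin (d+1)) (Ym d) b ≃* Multiplicative (ℕ →₀ ℤ)) := by
  rcases lt_trichotomy b.1.1 0 with h | h | h
  · exact model_free hd h
  · set S := {v : E d | ∃ k : ℤ, v = kap d k} with hS
    have hne : S.Nonempty := ⟨kap d 0, 0, rfl⟩
    let e : Ym d ≃ₜ Ym d := (shearW (fun v => Metric.infDist v S)
      (Metric.continuous_infDist_pt S)).subtype (fun y => by
        refine not_congr ?_
        change (_ ∧ _) ↔ (_ ∧ _)
        refine and_congr_left ?_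
        intro hy
        change y.2 ∈ S at hy
        simp [shearW, Metric.infDist_zero_of_mem hy])
    obtain ⟨E1⟩ := hgEquiv_of_homeo (N := Fin (d+1)) e (rfl : e b = e b)
    have hlt : (e b).1.1 < 0 := by
      change b.1.1 - Metric.infDist b.1.2 S < 0
      have : b.1.2 ∉ S := fun hm => b.2 ⟨h, hm⟩
      have := ((isClosed_range_kap (d := d)).notMem_iff_infDist_pos hne).1 this
      rw [h]
      linarith
    obtain ⟨E2⟩ := model_free hd hlt
    exact ⟨E1.trans E2⟩
  · let e : Ym d ≃ₜ Ym d := (flipW d).subtype (fun y => by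
        refine not_congr ?_
        change (_ ∧ _) ↔ (_ ∧ _)
        simp [flipW])
    obtain ⟨E1⟩ := hgEquiv_of_homeo (N := Fin (d+1)) e (rfl : e b = e b)
    have hlt : (e b).1.1 < 0 := by
      change - b.1.1 < 0
      linarith
    obtain ⟨E2⟩ := model_free hd hlt
    exact ⟨E1.trans E2⟩

/-- Euclidean space -/
abbrev V (d : ℕ) : Type := EuclideanSpace ℝ (Fin (d+1))

/-- difference model -/
abbrev Yd (d : ℕ) : Type := {y : ℝ × V d // ¬ ((∃ k : ℤ, y.1 = k) ∧ y.2 = 0)}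

/-- exchange of coordinates -/
noncomputable def swapW (d : ℕ) : (ℝ × V d) ≃ₜ W d where
  toFun y := (y.2 0, Function.update y.2.ofLp 0 y.1)
  invFun y := (y.2 0, WithLp.toLp 2 (Function.update y.2 0 y.1))
  left_inv y := by
    ext j
    · simp
    · simp
  right_inv y := by
    ext j <;> simp
  continuous_toFun := by
    refine Continuous.prodMk (by fun_prop) ?_
    exact Continuous.update (by fun_prop) 0 continuous_fst
  continuous_invFun := by
    refine Continuous.prodMk (by fun_prop) ?_
    refine (PiLp.continuous_toLp 2 _).comp ?_
    exact Continuous.update (by fun_prop) 0 continuous_fst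

theorem yd_free (hd : 1 ≤ d) (b : Yd d) :
    Nonempty (HomotopyGroup (Fin (d+1)) (Yd d) b ≃* Multiplicative (ℕ →₀ ℤ)) := by
  let e : Yd d ≃ₜ Ym d := (swapW d).subtype (fun y => by
    refine not_congr ?_
    change _ ↔ (_ ∧ ∃ k : ℤ, _)
    constructor
    · rintro ⟨⟨k, hk⟩, h0⟩
      refine ⟨by simp [swapW, h0], k, ?_⟩
      simp only [swapW, Homeomorph.homeomorph_mk_coe, Equiv.coe_fn_mk, h0, hk, kap]
      rfl
    · rintro ⟨h0, k, hk⟩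
      change Function.update y.2.ofLp 0 y.1 = Pi.single 0 (k:ℝ) at hk
      change y.2 0 = 0 at h0
      refine ⟨⟨k, by simpa using congrFun hk 0⟩, ?_⟩
      ext j
      by_cases hj : j = 0
      · subst hj; simpa using h0
      · have := congrFun hk j
        simpa [hj] using this)
  obtain ⟨E1⟩ := hgEquiv_of_homeo (N := Fin (d+1)) e (rfl : e b = e b)
  obtain ⟨E2⟩ := ym_free hd (e b)
  exact ⟨E1.trans E2⟩

/-- The universal-cover-like space of pairs. -/
abbrev Xt (d : ℕ) : Type := {z : (ℝ × ℝ) × (V d × V d) // ‖z.2.1‖ ≤ 1 ∧ ‖z.2.2‖ ≤ 1 ∧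
  ¬ ((∃ k : ℤ, z.1.2 - z.1.1 = k) ∧ z.2.2 - z.2.1 = 0)}

/-- difference map -/
def dif (z : Xt d) : Yd d := ⟨(z.1.1.2 - z.1.1.1, z.1.2.2 - z.1.2.1), z.2.2.2⟩

lemma dif_cont : Continuous (dif (d := d)) := by
  unfold dif
  exact Continuous.subtype_mk (by fun_prop) _

/-- raw section -/
noncomputable def secW (z₀ : Xt d) (y : ℝ × V d) : (ℝ × ℝ) × (V d × V d) :=
  ((z₀.1.1.1, z₀.1.1.1 + y.1),
    ((1 + ‖y.2 - (z₀.1.2.2 - z₀.1.2.1)‖)⁻¹ • (z₀.1.2.1 - (1/2 : ℝ) • (y.2 - (z₀.1.2.2 - z₀.1.2.1))),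
     (1 + ‖y.2 - (z₀.1.2.2 - z₀.1.2.1)‖)⁻¹ • (z₀.1.2.2 + (1/2 : ℝ) • (y.2 - (z₀.1.2.2 - z₀.1.2.1)))))

lemma secW_dif (z₀ : Xt d) (y : ℝ × V d) : (secW z₀ y).2.2 - (secW z₀ y).2.1 =
    (1 + ‖y.2 - (z₀.1.2.2 - z₀.1.2.1)‖)⁻¹ • y.2 := by
  simp only [secW, ← smul_sub]
  congr 1
  module

lemma ball_aux {u x : V d} (c : ℝ) (hc : |c| ≤ 1) (hx : ‖x‖ ≤ 1) : ‖(1 + ‖u‖)⁻¹ • (x + c • u)‖ ≤ 1 := by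
  have h0 : 0 ≤ ‖u‖ := norm_nonneg u
  rw [norm_smul, norm_inv, Real.norm_of_nonneg (by linarith), inv_mul_le_one₀ (by linarith)]
  refine (norm_add_le _ _).trans ?_
  rw [norm_smul, Real.norm_eq_abs]
  nlinarith

lemma secW_n1 (z₀ : Xt d) (y : ℝ × V d) : ‖(secW z₀ y).2.1‖ ≤ 1 := by
  have := ball_aux (u := y.2 - (z₀.1.2.2 - z₀.1.2.1)) (x := z₀.1.2.1) (-(1/2))
    (by rw [abs_neg, abs_of_pos] <;> norm_num) z₀.2.1
  rw [neg_smul, ← sub_eq_add_neg] at this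
  exact this

lemma secW_n2 (z₀ : Xt d) (y : ℝ × V d) : ‖(secW z₀ y).2.2‖ ≤ 1 :=
  ball_aux (u := y.2 - (z₀.1.2.2 - z₀.1.2.1)) (x := z₀.1.2.2) (1/2)
    (by rw [abs_of_pos] <;> norm_num) z₀.2.2.1

lemma secW_cont (z₀ : Xt d) : Continuous (secW z₀) := by
  have h : Continuous fun y : ℝ × V d => (1 + ‖y.2 - (z₀.1.2.2 - z₀.1.2.1)‖)⁻¹ := by
    refine Continuous.inv₀ (by fun_prop) fun y => ?_
    have := norm_nonneg (y.2 - (z₀.1.2.2 - z₀.1.2.1))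
    positivity
  unfold secW
  fun_prop

/-- section -/
noncomputable def sec (z₀ : Xt d) (y : Yd d) : Xt d :=
  ⟨secW z₀ y.1, secW_n1 _ _, secW_n2 _ _, by
    rintro ⟨⟨k, hk⟩, h0⟩
    refine y.2 ⟨⟨k, by simpa [secW] using hk⟩, ?_⟩
    rw [secW_dif] at h0
    have := norm_nonneg (y.1.2 - (z₀.1.2.2 - z₀.1.2.1))
    exact (smul_eq_zero.1 h0).resolve_left (by positivity)⟩

lemma comb_norm {u v : V d} (t : I) (hu : ‖u‖ ≤ 1) (hv : ‖v‖ ≤ 1) :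
    ‖(1 - (t : ℝ)) • u + (t : ℝ) • v‖ ≤ 1 := by
  have h1 := t.2.1
  have h2 := t.2.2
  refine (norm_add_le _ _).trans ?_
  rw [norm_smul, norm_smul, Real.norm_of_nonneg (by linarith), Real.norm_of_nonneg h1]
  nlinarith

theorem xt_free (hd : 1 ≤ d) (z₀ : Xt d) :
    Nonempty (HomotopyGroup (Fin (d+1)) (Xt d) z₀ ≃* Multiplicative (ℕ →₀ ℤ)) := by
  have hbase : secW z₀ (dif z₀).1 = z₀.1 := by
    ext <;> simp [secW, dif]
  obtain ⟨E1⟩ := hgEquiv_of_homotopyEquiv (N := Fin (d+1)) (f := dif) (g := sec z₀) (x := z₀)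
    (y := dif z₀) dif_cont
    (Continuous.subtype_mk ((secW_cont z₀).comp continuous_subtype_val) _) rfl
    (Subtype.ext hbase)
    (fun q => ⟨(1 - (q.1 : ℝ)) • secW z₀ (dif q.2).1 + (q.1 : ℝ) • q.2.1, by
      exact comb_norm q.1 (secW_n1 _ _) q.2.2.1, by
      exact comb_norm q.1 (secW_n2 _ _) q.2.2.2.1, by
      rintro ⟨⟨k, hk⟩, h0⟩
      refine q.2.2.2.2 ⟨⟨k, ?_⟩, ?_⟩
      · rw [← hk]
        simp only [Prod.fst_add, Prod.snd_add, Prod.smul_fst, Prod.smul_snd, secW, dif, smul_eq_mul]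
        ring
      · have h1 : ((1 - (q.1 : ℝ)) * (1 + ‖(dif q.2).1.2 - (z₀.1.2.2 - z₀.1.2.1)‖)⁻¹ + (q.1 : ℝ)) •
            (q.2.1.2.2 - q.2.1.2.1) = 0 := by
          have h2 : (1 + ‖(dif q.2).1.2 - (z₀.1.2.2 - z₀.1.2.1)‖)⁻¹ • (q.2.1.2.2 - q.2.1.2.1) = _ :=
            (secW_dif z₀ (dif q.2).1).symm
          rw [add_smul, mul_smul, h2]
          refine Eq.trans ?_ h0
          simp only [Prod.fst_add, Prod.snd_add, Prod.smul_fst, Prod.smul_snd]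
          module
        refine (smul_eq_zero.1 h1).resolve_left (ne_of_gt ?_)
        have hp : 0 < (1 + ‖(dif q.2).1.2 - (z₀.1.2.2 - z₀.1.2.1)‖)⁻¹ := by positivity
        rcases eq_or_lt_of_le q.1.2.1 with h | h
        · rw [← h]; simpa using hp
        · have : 0 ≤ 1 - (q.1 : ℝ) := by linarith [q.1.2.2]
          positivity⟩) (by
      refine Continuous.subtype_mk ?_ _
      have h1 : Continuous fun q : I × Xt d => secW z₀ (dif q.2).1 :=
        (secW_cont z₀).comp (continuous_subtype_val.comp (dif_cont.comp continuous_snd))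
      fun_prop)
    (fun z => Subtype.ext (by simp [sec])) (fun z => Subtype.ext (by simp))
    (fun s => Subtype.ext (by
      simp only [hbase]
      rw [← add_smul]
      simp))
    (fun q => ⟨(q.2.1.1, (1 + (1 - (q.1 : ℝ)) * ‖q.2.1.2 - (z₀.1.2.2 - z₀.1.2.1)‖)⁻¹ • q.2.1.2), by
      rintro ⟨h1, h2⟩
      have := norm_nonneg (q.2.1.2 - (z₀.1.2.2 - z₀.1.2.1))
      have h3 : 0 ≤ 1 - (q.1 : ℝ) := by linarith [q.1.2.2]
      exact q.2.2 ⟨h1, (smul_eq_zero.1 h2).resolve_left (by positivity)⟩⟩) (by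
      refine Continuous.subtype_mk ?_ _
      have h : Continuous fun q : I × Yd d =>
          (1 + (1 - (q.1 : ℝ)) * ‖q.2.1.2 - (z₀.1.2.2 - z₀.1.2.1)‖)⁻¹ := by
        refine Continuous.inv₀ (by fun_prop) fun q => ?_
        have := norm_nonneg (q.2.1.2 - (z₀.1.2.2 - z₀.1.2.1))
        have h3 : 0 ≤ 1 - (q.1 : ℝ) := by linarith [q.1.2.2]
        positivity
      fun_prop)
    (fun z => Subtype.ext (by
      refine Prod.ext ?_ ?_
      · simp [sec, dif, secW]
      · simp only [sec, dif, secW_dif]; simp))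
    (fun z => Subtype.ext (by simp))
    (fun s => Subtype.ext (by simp [dif]))
  obtain ⟨E2⟩ := yd_free hd (dif z₀)
  exact ⟨E1.trans E2⟩
end CP

namespace CP
open scoped Topology Topology.Homotopy unitInterval
open Set
variable {d : ℕ}

/-- the plane -/
abbrev E2 : Type := EuclideanSpace ℝ (Fin 2)

/-- circle parametrisation -/
noncomputable def ee (a : ℝ) : E2 := !₂[Real.cos (2 * Real.pi * a), Real.sin (2 * Real.pi * a)]

@[simp] lemma ee_zero (a : ℝ) : ee a 0 = Real.cos (2 * Real.pi * a) := rfl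
@[simp] lemma ee_one (a : ℝ) : ee a 1 = Real.sin (2 * Real.pi * a) := rfl

lemma ee_cont : Continuous ee := by
  unfold ee
  refine (PiLp.continuous_toLp 2 _).comp (continuous_pi fun i => ?_)
  fin_cases i <;> simp <;> fun_prop

lemma e2_norm (v : E2) : ‖v‖ = 1 ↔ v 0 ^ 2 + v 1 ^ 2 = 1 := by
  rw [EuclideanSpace.norm_eq, Real.sqrt_eq_one]
  simp [Fin.sum_univ_two]

lemma ee_norm (a : ℝ) : ‖ee a‖ = 1 := by
  rw [e2_norm]; simp

/-- unit vectors to the circle -/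
noncomputable def toC (v : E2) (h : ‖v‖ = 1) : Circle :=
  ⟨⟨v 0, v 1⟩, by
    change _ ∈ Metric.sphere (0 : ℂ) 1
    rw [mem_sphere_zero_iff_norm, ← sq_eq_sq₀ (norm_nonneg _) zero_le_one, ← Complex.normSq_eq_norm_sq,
      Complex.normSq_mk]
    have := (e2_norm v).1 h
    nlinarith⟩

lemma toC_eq {v : E2} (h : ‖v‖ = 1) (a : ℝ) : Circle.exp (2 * Real.pi * a) = toC v h ↔ ee a = v := by
  constructor
  · intro hh
    have h1 : (Circle.exp (2 * Real.pi * a) : ℂ) = (toC v h : ℂ) := by rw [hh]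
    rw [Circle.coe_exp] at h1
    have h2 := congrArg Complex.re h1
    have h3 := congrArg Complex.im h1
    rw [Complex.exp_ofReal_mul_I_re] at h2
    rw [Complex.exp_ofReal_mul_I_im] at h3
    ext i
    fin_cases i
    · exact h2
    · exact h3
  · rintro rfl
    apply Circle.ext
    rw [Circle.coe_exp]
    apply Complex.ext
    · rw [Complex.exp_ofReal_mul_I_re]; rfl
    · rw [Complex.exp_ofReal_mul_I_im]; rfl

lemma ee_surj (v : E2) (h : ‖v‖ = 1) : ∃ a, ee a = v := by
  have ht := Circle.exp_arg (toC v h)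
  refine ⟨(Complex.arg (toC v h)) / (2 * Real.pi), (toC_eq h _).1 ?_⟩
  rw [mul_div_cancel₀ _ (by positivity)]
  exact ht

lemma ee_eq_iff (a b : ℝ) : ee a = ee b ↔ ∃ k : ℤ, a - b = k := by
  constructor
  · intro h
    have h1 : Circle.exp (2 * Real.pi * a) = Circle.exp (2 * Real.pi * b) := by
      rw [toC_eq (ee_norm b) a |>.2 h, toC_eq (ee_norm b) b |>.2 rfl]
    rw [Circle.exp_eq_exp] at h1
    obtain ⟨m, hm⟩ := h1
    refine ⟨m, ?_⟩
    have : (2 * Real.pi) * (a - b) = (2 * Real.pi) * m := by linarith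
    exact mul_left_cancel₀ (by positivity) this
  · rintro ⟨k, hk⟩
    obtain rfl : a = b + k := by linarith
    ext i
    have : 2 * Real.pi * (b + k) = 2 * Real.pi * b + k * (2 * Real.pi) := by ring
    fin_cases i
    · simp [this, Real.cos_add_int_mul_two_pi]
    · simp [this, Real.sin_add_int_mul_two_pi]

lemma ang_lift {A : Type*} [TopologicalSpace A] [SimplyConnectedSpace A] [LocallyPathConnectedSpace A]
    (f : A → E2) (hf : Continuous f) (h1 : ∀ a, ‖f a‖ = 1) (a₀ : A) (t₀ : ℝ) (h0 : ee t₀ = f a₀) :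
    ∃ t : A → ℝ, Continuous t ∧ t a₀ = t₀ ∧ ∀ a, ee (t a) = f a := by
  have hc : Continuous fun a => toC (f a) (h1 a) := by
    refine Continuous.subtype_mk ?_ _
    have e1 : (fun a => (⟨f a 0, f a 1⟩ : ℂ)) = fun a => (f a 0 : ℂ) + (f a 1 : ℂ) * Complex.I := by
      funext a
      exact Complex.mk_eq_add_mul_I _ _
    rw [e1]
    fun_prop
  obtain ⟨F, ⟨hF0, hF⟩, -⟩ := Circle.isCoveringMap_exp.existsUnique_continuousMap_lifts
    ⟨fun a => toC (f a) (h1 a), hc⟩ a₀ (2 * Real.pi * t₀) ((toC_eq (h1 a₀) t₀).2 h0)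
  have hpi : (2 * Real.pi) ≠ 0 := by positivity
  refine ⟨fun a => F a / (2 * Real.pi), by fun_prop, ?_, fun a => (toC_eq (h1 a) _).1 ?_⟩
  · change F a₀ / (2 * Real.pi) = t₀
    rw [hF0]; field_simp
  · have := congrFun hF a
    rw [mul_div_cancel₀ _ hpi]
    exact this

/-- the space `S¹ × D^(d+1)` -/
abbrev SD (d : ℕ) : Type := {p : E2 × V d // ‖p.1‖ = 1 ∧ ‖p.2‖ ≤ 1}

/-- configurations of two points -/
abbrev C2 (d : ℕ) : Type := {p : Fin 2 → SD d // ∀ i j : Fin 2, i ≠ j → p i ≠ p j}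

/-- covering projection -/
noncomputable def PP (z : Xt d) : C2 d :=
  ⟨![⟨(ee z.1.1.1, z.1.2.1), ee_norm _, z.2.1⟩, ⟨(ee z.1.1.2, z.1.2.2), ee_norm _, z.2.2.1⟩], by
    have key : (⟨(ee z.1.1.1, z.1.2.1), ee_norm _, z.2.1⟩ : SD d) ≠
        ⟨(ee z.1.1.2, z.1.2.2), ee_norm _, z.2.2.1⟩ := by
      intro h
      have h' := congrArg Subtype.val h
      have h1 := congrArg Prod.fst h'
      have h2 : z.1.2.1 = z.1.2.2 := congrArg Prod.snd h'
      exact z.2.2.2 ⟨(ee_eq_iff _ _).1 h1.symm, by rw [h2, sub_self]⟩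
    intro i j hij
    fin_cases i <;> fin_cases j <;> first | exact absurd rfl hij | exact key | exact key.symm⟩

lemma PP_cont : Continuous (PP (d := d)) := by
  refine Continuous.subtype_mk (continuous_pi fun i => ?_) _
  have := ee_cont
  fin_cases i
  · exact Continuous.subtype_mk (by fun_prop) _
  · exact Continuous.subtype_mk (by fun_prop) _

lemma PP_eq_iff (z : Xt d) (y : C2 d) : PP z = y ↔
    (ee z.1.1.1 = (y.1 0).1.1 ∧ ee z.1.1.2 = (y.1 1).1.1) ∧
      z.1.2.1 = (y.1 0).1.2 ∧ z.1.2.2 = (y.1 1).1.2 := by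
  constructor
  · rintro rfl
    exact ⟨⟨rfl, rfl⟩, rfl, rfl⟩
  · rintro ⟨⟨h1, h2⟩, h3, h4⟩
    refine Subtype.ext (funext fun i => Subtype.ext ?_)
    fin_cases i
    · exact Prod.ext h1 h3
    · exact Prod.ext h2 h4

/-- a constructor for points in the cover -/
def mkXt (y : C2 d) (a b : ℝ) (ha : ee a = (y.1 0).1.1) (hb : ee b = (y.1 1).1.1) : Xt d :=
  ⟨((a, b), ((y.1 0).1.2, (y.1 1).1.2)), (y.1 0).2.2, (y.1 1).2.2, by
    rintro ⟨hk, h0⟩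
    refine y.2 0 1 (by decide) (Subtype.ext (Prod.ext ?_ ?_))
    · rw [← ha, ← hb]; exact ((ee_eq_iff _ _).2 hk).symm
    · exact (sub_eq_zero.1 h0).symm⟩

lemma PP_surj (y : C2 d) : ∃ z, PP z = y := by
  obtain ⟨a, ha⟩ := ee_surj _ (y.1 0).2.1
  obtain ⟨b, hb⟩ := ee_surj _ (y.1 1).2.1
  exact ⟨mkXt y a b ha hb, (PP_eq_iff _ _).2 ⟨⟨ha, hb⟩, rfl, rfl⟩⟩

lemma PP_lift {A : Type*} [TopologicalSpace A] [SimplyConnectedSpace A] [LocallyPathConnectedSpace A]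
    (f : A → C2 d) (hf : Continuous f) (a₀ : A) (z₀ : Xt d) (h0 : PP z₀ = f a₀) :
    ∃ F : A → Xt d, Continuous F ∧ F a₀ = z₀ ∧ ∀ a, PP (F a) = f a := by
  rw [PP_eq_iff] at h0
  obtain ⟨⟨h1, h2⟩, h3, h4⟩ := h0
  have hv (i : Fin 2) : Continuous fun a => ((f a).1 i).1 :=
    continuous_subtype_val.comp ((continuous_apply i).comp (continuous_subtype_val.comp hf))
  have hv1 (i : Fin 2) := continuous_fst.comp (hv i)
  have hv2 (i : Fin 2) := continuous_snd.comp (hv i)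
  obtain ⟨s, hs, hs0, hs1⟩ := ang_lift (fun a => ((f a).1 0).1.1) (hv1 0)
    (fun a => ((f a).1 0).2.1) a₀ _ h1
  obtain ⟨t, ht, ht0, ht1⟩ := ang_lift (fun a => ((f a).1 1).1.1) (hv1 1)
    (fun a => ((f a).1 1).2.1) a₀ _ h2
  refine ⟨fun a => mkXt (f a) (s a) (t a) (hs1 a) (ht1 a), ?_, ?_, ?_⟩
  · refine Continuous.subtype_mk ?_ _
    exact (hs.prodMk ht).prodMk ((hv2 0).prodMk (hv2 1))
  · exact Subtype.ext (Prod.ext (Prod.ext hs0 ht0) (Prod.ext h3.symm h4.symm))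
  · intro a
    exact (PP_eq_iff _ _).2 ⟨⟨hs1 a, ht1 a⟩, rfl, rfl⟩

lemma ang_uniq {A : Type*} [TopologicalSpace A] {S : Set A} (hS : IsPreconnected S)
    {s t : A → ℝ} (hs : Continuous s) (ht : Continuous t)
    (h : ∀ a ∈ S, ee (s a) = ee (t a)) {a₀ : A} (h₀ : a₀ ∈ S) (h0 : s a₀ = t a₀) :
    ∀ a ∈ S, s a = t a := by
  intro a ha
  have hd : IsDiscrete (range ((↑) : ℤ → ℝ)) := by
    rw [← image_univ]
    exact IsDiscrete.univ.image Int.isClosedEmbedding_coe_real.isEmbedding.isInducing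
  have := hS.constant_of_mapsTo hd (f := fun a => s a - t a)
    (hs.sub ht).continuousOn (fun a ha => by
      obtain ⟨k, hk⟩ := (ee_eq_iff _ _).1 (h a ha)
      exact ⟨k, hk.symm⟩) ha h₀
  simp only [h0, sub_self] at this
  linarith

lemma PP_uniq {A : Type*} [TopologicalSpace A] {S : Set A} (hS : IsPreconnected S)
    {F G : A → Xt d} (hF : Continuous F) (hG : Continuous G)
    (h : ∀ a ∈ S, PP (F a) = PP (G a)) {a₀ : A} (h₀ : a₀ ∈ S) (h0 : F a₀ = G a₀) :
    ∀ a ∈ S, F a = G a := by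
  intro a ha
  have h1 := ang_uniq hS (s := fun a => (F a).1.1.1) (t := fun a => (G a).1.1.1) (by fun_prop)
    (by fun_prop) (fun a ha => ((PP_eq_iff _ _).1 (h a ha)).1.1) h₀ (by simp only [h0]) a ha
  have h2 := ang_uniq hS (s := fun a => (F a).1.1.2) (t := fun a => (G a).1.1.2) (by fun_prop)
    (by fun_prop) (fun a ha => ((PP_eq_iff _ _).1 (h a ha)).1.2) h₀ (by simp only [h0]) a ha
  have h3 := ((PP_eq_iff _ _).1 (h a ha)).2
  exact Subtype.ext (Prod.ext (Prod.ext h1 h2) (Prod.ext h3.1 h3.2))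

lemma face_conn (i : Fin (d+1)) (ε : I) : IsPreconnected {t : Fin (d+1) → I | t i = ε} := by
  have : {t : Fin (d+1) → I | t i = ε} = range fun t : Fin (d+1) → I => Function.update t i ε := by
    ext t
    constructor
    · rintro rfl
      exact ⟨t, by simp⟩
    · rintro ⟨t, rfl⟩
      simp
  rw [this]
  exact isPreconnected_range (by fun_prop)

lemma bdry_conn (hd : 1 ≤ d) : IsPreconnected (Cube.boundary (Fin (d+1))) := by
  refine isPreconnected_of_forall (0 : Fin (d+1) → I) ?_
  rintro t ⟨i, h | h⟩
  · exact ⟨{t | t i = 0}, fun t ht => ⟨i, Or.inl ht⟩, rfl, h, face_conn i 0⟩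
  · have : Nontrivial (Fin (d+1)) := Fin.nontrivial_iff_two_le.2 (by omega)
    obtain ⟨j, hj⟩ := exists_ne i
    refine ⟨{t | t i = 1} ∪ {t | t j = 0}, ?_, Or.inr rfl, Or.inl h, ?_⟩
    · rintro t (ht | ht)
      · exact ⟨i, Or.inr ht⟩
      · exact ⟨j, Or.inl ht⟩
    · refine IsPreconnected.union (Function.update (0 : Fin (d+1) → I) i 1) ?_ ?_ (face_conn i 1) (face_conn j 0)
      · simp
      · simp [hj]

lemma cube_lift (f : (Fin (d+1) → I) → C2 d) (hf : Continuous f) (z₀ : Xt d) (h0 : PP z₀ = f 0) :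
    ∃ F : (Fin (d+1) → I) → Xt d, Continuous F ∧ F 0 = z₀ ∧ ∀ a, PP (F a) = f a := by
  have e0 : clE (fun i => (((0 : Fin (d+1) → I) i : I) : ℝ)) = 0 := clE_coe _
  obtain ⟨F, h1, h2, h3⟩ := PP_lift (fun x : E d => f (clE x)) (hf.comp clE_cont)
    (fun i => (((0 : Fin (d+1) → I) i : I) : ℝ)) z₀ (by rw [e0]; exact h0)
  refine ⟨fun t => F (fun i => (t i : ℝ)), h1.comp (by fun_prop), h2, fun a => ?_⟩
  rw [h3, clE_coe]

lemma homot_lift (f : I × (Fin (d+1) → I) → C2 d) (hf : Continuous f) (z₀ : Xt d)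
    (h0 : PP z₀ = f (0, 0)) :
    ∃ F : I × (Fin (d+1) → I) → Xt d, Continuous F ∧ F (0, 0) = z₀ ∧ ∀ a, PP (F a) = f a := by
  have e0 : clE (fun i => (((0 : Fin (d+1) → I) i : I) : ℝ)) = 0 := clE_coe _
  have e1 (s : I) : projIcc (0:ℝ) 1 zero_le_one (s : ℝ) = s := projIcc_val _ s
  have hc : Continuous fun x : ℝ × E d => f (projIcc (0:ℝ) 1 zero_le_one x.1, clE x.2) := by
    have := clE_cont (d := d)
    have := continuous_projIcc (a := (0:ℝ)) (b := 1) (h := zero_le_one)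
    fun_prop
  obtain ⟨F, h1, h2, h3⟩ := PP_lift _ hc
    (((0 : I) : ℝ), fun i => (((0 : Fin (d+1) → I) i : I) : ℝ)) z₀ (by
      simp only [e0, e1]; exact h0)
  refine ⟨fun t => F ((t.1 : ℝ), fun i => (t.2 i : ℝ)), h1.comp (by fun_prop), h2, fun a => ?_⟩
  rw [h3, clE_coe, e1]

theorem c2_free (hd : 1 ≤ d) (y : C2 d) :
    Nonempty (HomotopyGroup (Fin (d+1)) (C2 d) y ≃* Multiplicative (ℕ →₀ ℤ)) := by
  obtain ⟨z₀, rfl⟩ := PP_surj y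
  obtain ⟨E2⟩ := xt_free hd z₀
  have hz : (0 : Fin (d+1) → I) ∈ Cube.boundary (Fin (d+1)) := ⟨0, Or.inl rfl⟩
  have hbij : Function.Bijective (hgMap (N := Fin (d+1)) (PP (d := d)) PP_cont (rfl : PP z₀ = PP z₀)) := by
    constructor
    · intro a b hab
      obtain ⟨p, rfl⟩ := cls_surj a
      obtain ⟨q, rfl⟩ := cls_surj b
      rw [hgMap_cls, hgMap_cls] at hab
      obtain ⟨H, hH, H0, H1, Hb⟩ := exists_of_cls_eq hab
      obtain ⟨F, hF, F0, hP⟩ := homot_lift H hH z₀ (Hb 0 0 hz).symm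
      have Fb : ∀ x ∈ (univ ×ˢ Cube.boundary (Fin (d+1)) : Set (I × (Fin (d+1) → I))), F x = z₀ :=
        PP_uniq (isPreconnected_univ.prod (bdry_conn hd)) hF continuous_const
          (fun x hx => by rw [hP]; exact Hb x.1 x.2 hx.2) (a₀ := (0, 0)) ⟨mem_univ _, hz⟩ F0
      refine cls_eq_of F hF ?_ ?_ (fun s t ht => Fb (s, t) ⟨mem_univ _, ht⟩)
      · intro t
        exact PP_uniq isPreconnected_univ (F := fun t => F (0, t)) (G := p) (by fun_prop) (gl_cont p)
          (fun t _ => by rw [hP, H0]; rfl) (mem_univ 0)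
          (by rw [GenLoop.boundary p 0 hz]; exact F0) t (mem_univ t)
      · intro t
        exact PP_uniq isPreconnected_univ (F := fun t => F (1, t)) (G := q) (by fun_prop) (gl_cont q)
          (fun t _ => by rw [hP, H1]; rfl) (mem_univ 0)
          (by rw [GenLoop.boundary q 0 hz]; exact Fb (1, 0) ⟨mem_univ _, hz⟩) t (mem_univ t)
    · intro b
      obtain ⟨q, rfl⟩ := cls_surj b
      obtain ⟨F, hF, F0, hP⟩ := cube_lift q (gl_cont q) z₀ (GenLoop.boundary q 0 hz).symm
      refine ⟨cls (mkGL F hF ?_), ?_⟩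
      · exact PP_uniq (bdry_conn hd) hF continuous_const
          (fun t ht => by rw [hP]; exact GenLoop.boundary q t ht) hz F0
      · rw [hgMap_cls]
        congr 1
        exact Subtype.ext (ContinuousMap.ext hP)
  exact ⟨(MulEquiv.ofBijective _ hbij).symm.trans E2⟩
end CP

/-- For every `n ≥ 4`, the homotopy group `π_{n-1}` of the configuration space
`C₂(S¹ × D^{n-1})`, at any basepoint, is a free abelian group of countably infinite rank,
i.e. isomorphic to `⊕_ℕ ℤ`. -/
theorem pi_n_sub_one_conf_two_S1xD (n : ℕ) (hn : 4 ≤ n) (y : Conf 2 (S1xD n)) :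
    haveI : Nonempty (Fin (n - 1)) := ⟨⟨0, by omega⟩⟩
    Nonempty (HomotopyGroup (Fin (n - 1)) (Conf 2 (S1xD n)) y ≃* Multiplicative (ℕ →₀ ℤ)) := by
  obtain ⟨d, rfl⟩ : ∃ d, n = d + 2 := ⟨n - 2, by omega⟩
  exact CP.c2_free (d := d) (by omega) y
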